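/- arXiv:1403.7939 — 6 statements merged into one kernel-verified Lean document; each statement's English description precedes it below -/
import Mathlib

section
/- Let a, b be natural numbers, let P be a nonempty finite set of points and L a nonempty finite set of lines in the real projective plane such that exactly a points of P have degree 3, exactly b points of P have degree 4, every point of P has degree 3 or 4, exactly a lines of L have degree 3, exactly b lines of L have degree 4, and every line of L has degree 3 or 4. Then −(a+b)² + 7a + 15b + 6 ≤ 0. -/
/- Model of the real projective plane: a point is a 1-dimensional linear subspace
of ℝ³ and a line is a 2-dimensional linear subspace of ℝ³; a point p is incident
to a line ℓ when p ≤ ℓ. -/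

open scoped Classical

/-- The degree of a point `p` with respect to a finite set `L` of lines:
the number of lines of `L` incident to `p`. -/
noncomputable def pointDeg (L : Finset (Submodule ℝ (Fin 3 → ℝ)))
    (p : Submodule ℝ (Fin 3 → ℝ)) : ℕ :=
  (L.filter fun l => p ≤ l).card

/-- The degree of a line `l` with respect to a finite set `P` of points:
the number of points of `P` incident to `l`. -/
noncomputable def lineDeg (P : Finset (Submodule ℝ (Fin 3 → ℝ)))
    (l : Submodule ℝ (Fin 3 → ℝ)) : ℕ :=
  (P.filter fun p => p ≤ l).card

/-- The number of incidences of `(P, L)`: the number of pairs `(p, ℓ) ∈ P × L`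
with `p` incident to `ℓ`. -/
noncomputable def incCount (P L : Finset (Submodule ℝ (Fin 3 → ℝ))) : ℕ :=
  ((P ×ˢ L).filter fun pl => pl.1 ≤ pl.2).card

/-- A point of the real projective plane: a 1-dimensional linear subspace of ℝ³. -/
def IsProjPoint (p : Submodule ℝ (Fin 3 → ℝ)) : Prop := Module.finrank ℝ p = 1

/-- A line of the real projective plane: a 2-dimensional linear subspace of ℝ³. -/
def IsProjLine (l : Submodule ℝ (Fin 3 → ℝ)) : Prop := Module.finrank ℝ l = 2

section PlanarPoints

variable {α : Type*} (x y : α → ℝ) (S : Finset α)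

/-- Twice the signed area of the triangle `p q r`, where `x` and `y` are the coordinates. -/
def orient (p q r : α) : ℝ := (x q - x p) * (y r - y p) - (y q - y p) * (x r - x p)

/-- The points of `S` on the line through `p` and `q`. -/
noncomputable def lineThrough (p q : α) : Finset α := S.filter fun r => orient x y p q r = 0

/-- The points of `S` strictly to the right of the line directed from `p` to `q`. -/
noncomputable def rightSide (p q : α) : Finset α := S.filter fun r => orient x y p q r < 0

/-- The lines spanned by pairs of distinct points of `S`. -/
noncomputable def spannedLines : Finset (Finset α) :=
  S.offDiag.image fun e => lineThrough x y S e.1 e.2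

/-- The spanned lines, each paired with one of its sides. -/
noncomputable def sidedLines : Finset (Finset α × Finset α) :=
  S.offDiag.image fun e => (lineThrough x y S e.1 e.2, rightSide x y S e.1 e.2)

variable {x y S}

lemma orient_swap (p q r : α) : orient x y q p r = -orient x y p q r := by
  unfold orient; ring

lemma orient_self_left (p q : α) : orient x y p q p = 0 := by
  unfold orient; ring

lemma orient_self_right (p q : α) : orient x y p q q = 0 := by
  unfold orient; ring

lemma left_mem_lineThrough {p q : α} (hp : p ∈ S) : p ∈ lineThrough x y S p q := by
  simp [lineThrough, hp, orient_self_left]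

lemma right_mem_lineThrough {p q : α} (hq : q ∈ S) : q ∈ lineThrough x y S p q := by
  simp [lineThrough, hq, orient_self_right]

lemma orient_mul_of_collinear {p q u v : α} (hu : orient x y p q u = 0)
    (hv : orient x y p q v = 0) (s : α) :
    orient x y u v s * (x q - x p) = (x v - x u) * orient x y p q s := by
  unfold orient at *
  linear_combination (-(x v - x u) + (x s - x u)) * hu - (x s - x u) * hv

lemma lineThrough_eq_of_mem (hx : Set.InjOn x S) {p q u v : α} (hp : p ∈ S) (hq : q ∈ S)
    (hpq : p ≠ q) (hu : u ∈ lineThrough x y S p q) (hv : v ∈ lineThrough x y S p q)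
    (huv : u ≠ v) : lineThrough x y S u v = lineThrough x y S p q := by
  simp only [lineThrough, Finset.mem_filter] at hu hv
  have h1 : x q - x p ≠ 0 := sub_ne_zero.2 fun h => hpq (hx hq hp h).symm
  have h2 : x v - x u ≠ 0 := sub_ne_zero.2 fun h => huv (hx hv.1 hu.1 h).symm
  refine Finset.filter_congr fun s _ => ?_
  have h := orient_mul_of_collinear hu.2 hv.2 s
  constructor
  · intro h0
    simpa [h0, h2] using h.symm
  · intro h0
    simpa [h0, h1] using h

lemma rightSide_eq_or (hx : Set.InjOn x S) {p q u v : α} (hp : p ∈ S) (hq : q ∈ S)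
    (hpq : p ≠ q) (hu : u ∈ lineThrough x y S p q) (hv : v ∈ lineThrough x y S p q)
    (huv : u ≠ v) :
    rightSide x y S u v = rightSide x y S p q ∨ rightSide x y S u v = rightSide x y S q p := by
  simp only [lineThrough, Finset.mem_filter] at hu hv
  have h1 : x q - x p ≠ 0 := sub_ne_zero.2 fun h => hpq (hx hq hp h).symm
  have h2 : x v - x u ≠ 0 := sub_ne_zero.2 fun h => huv (hx hv.1 hu.1 h).symm
  have key : ∀ s, orient x y u v s = (x v - x u) / (x q - x p) * orient x y p q s := fun s => by
    have h := orient_mul_of_collinear hu.2 hv.2 s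
    field_simp
    linarith
  rcases (div_ne_zero h2 h1).lt_or_gt with hc | hc
  · right
    refine Finset.filter_congr fun s _ => ?_
    rw [key, orient_swap p q s, neg_neg_iff_pos]
    exact ⟨fun h => by by_contra! h'; nlinarith, fun h => mul_neg_of_neg_of_pos hc h⟩
  · left
    refine Finset.filter_congr fun s _ => ?_
    rw [key]
    exact ⟨fun h => by by_contra! h'; nlinarith, fun h => mul_neg_of_pos_of_neg hc h⟩

lemma lineThrough_mem_spannedLines {p q : α} (hp : p ∈ S) (hq : q ∈ S) (hpq : p ≠ q) :
    lineThrough x y S p q ∈ spannedLines x y S :=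
  Finset.mem_image.2 ⟨(p, q), by simp [hp, hq, hpq], rfl⟩

lemma lineThrough_eq_of_mem_spannedLines (hx : Set.InjOn x S) {t : Finset α}
    (ht : t ∈ spannedLines x y S) {u v : α} (hu : u ∈ t) (hv : v ∈ t) (huv : u ≠ v) :
    lineThrough x y S u v = t := by
  obtain ⟨⟨p, q⟩, hpq, rfl⟩ := Finset.mem_image.1 ht
  simp only [Finset.mem_offDiag] at hpq
  exact lineThrough_eq_of_mem hx hpq.1 hpq.2.1 hpq.2.2 hu hv huv

lemma subset_of_mem_spannedLines {t : Finset α} (ht : t ∈ spannedLines x y S) : t ⊆ S := by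
  obtain ⟨⟨p, q⟩, -, rfl⟩ := Finset.mem_image.1 ht
  exact Finset.filter_subset _ _

lemma two_le_card_of_mem_spannedLines {t : Finset α} (ht : t ∈ spannedLines x y S) :
    2 ≤ t.card := by
  obtain ⟨⟨p, q⟩, hpq, rfl⟩ := Finset.mem_image.1 ht
  simp only [Finset.mem_offDiag] at hpq
  exact Finset.one_lt_card.2 ⟨p, left_mem_lineThrough hpq.1, q, right_mem_lineThrough hpq.2.1,
    hpq.2.2⟩

/-- Every ordered pair of distinct points lies on exactly one spanned line. -/
lemma sum_card_offDiag_spannedLines (hx : Set.InjOn x S) :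
    ∑ t ∈ spannedLines x y S, t.offDiag.card = S.offDiag.card := by
  rw [Finset.card_eq_sum_card_fiberwise (f := fun e => lineThrough x y S e.1 e.2)
    (t := spannedLines x y S) fun e he => Finset.mem_image_of_mem _ he]
  refine Finset.sum_congr rfl fun t ht => congrArg _ ?_
  ext ⟨u, v⟩
  simp only [Finset.mem_offDiag, Finset.mem_filter]
  constructor
  · rintro ⟨hu, hv, huv⟩
    exact ⟨⟨subset_of_mem_spannedLines ht hu, subset_of_mem_spannedLines ht hv, huv⟩,
      lineThrough_eq_of_mem_spannedLines hx ht hu hv huv⟩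
  · rintro ⟨⟨hu, hv, huv⟩, rfl⟩
    exact ⟨left_mem_lineThrough hu, right_mem_lineThrough hv, huv⟩

lemma card_sidedLines_le (hx : Set.InjOn x S) :
    (sidedLines x y S).card ≤ 2 * (spannedLines x y S).card := by
  refine Finset.card_le_mul_card_image_of_maps_to (f := Prod.fst) ?_ 2 ?_
  · intro e he
    obtain ⟨⟨p, q⟩, hpq, rfl⟩ := Finset.mem_image.1 he
    exact Finset.mem_image_of_mem (fun e : α × α => lineThrough x y S e.1 e.2) hpq
  · intro t ht
    obtain ⟨⟨p, q⟩, hpq, rfl⟩ := Finset.mem_image.1 ht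
    simp only [Finset.mem_offDiag] at hpq
    refine (Finset.card_le_card (t := {(lineThrough x y S p q, rightSide x y S p q),
      (lineThrough x y S p q, rightSide x y S q p)}) ?_).trans Finset.card_le_two
    intro e he
    simp only [Finset.mem_filter] at he
    obtain ⟨he, het⟩ := he
    obtain ⟨⟨u, v⟩, huv, rfl⟩ := Finset.mem_image.1 he
    simp only [Finset.mem_offDiag] at huv het
    have hu : u ∈ lineThrough x y S p q := het ▸ left_mem_lineThrough huv.1
    have hv : v ∈ lineThrough x y S p q := het ▸ right_mem_lineThrough huv.2.1
    rcases rightSide_eq_or hx hpq.1 hpq.2.1 hpq.2.2 hu hv huv.2.2 with h | h <;>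
      simp [h, het]

/-- `p` is the first point of the line `e.1`, directed so that `e.2` is its right side, and `q`
is the first point of `e.2` met when this line is rotated clockwise around `p`. -/
def IsSweepStart (x y : α → ℝ) (p q : α) (e : Finset α × Finset α) : Prop :=
  p ∈ e.1 ∧ (∀ r ∈ e.1, r ≠ p → ∀ s ∈ e.2, orient x y p r s < 0) ∧ q ∈ e.2 ∧
    ∀ s ∈ e.2, orient x y p q s ≤ 0 ∧
      (orient x y p q s = 0 → |x q - x p| ≤ |x s - x p|)

lemma IsSweepStart.unique (hx : Set.InjOn x S) {p q p' q' : α} {e : Finset α × Finset α}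
    (he : e ∈ sidedLines x y S) (h : IsSweepStart x y p q e) (h' : IsSweepStart x y p' q' e) :
    p = p' ∧ q = q' := by
  obtain ⟨hp, hr, hq, hs⟩ := h
  obtain ⟨hp', hr', hq', hs'⟩ := h'
  have hpp : p = p' := by
    by_contra hne
    have h1 := hr p' hp' (Ne.symm hne) q hq
    have h2 := hr' p hp hne q hq
    rw [orient_swap] at h2
    linarith
  subst hpp
  refine ⟨rfl, ?_⟩
  obtain ⟨⟨u, v⟩, huv, rfl⟩ := Finset.mem_image.1 he
  simp only [Finset.mem_offDiag] at huv
  obtain ⟨hu, hv, huv⟩ := huv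
  obtain ⟨r, hrt, hrp⟩ : ∃ r ∈ lineThrough x y S u v, r ≠ p := by
    by_cases hup : u = p
    · exact ⟨v, right_mem_lineThrough hv, fun h => huv (hup.trans h.symm)⟩
    · exact ⟨u, left_mem_lineThrough hu, hup⟩
  have h1 := hr r hrt hrp q hq
  have h2 := hr r hrt hrp q' hq'
  have h3 := (hs q' hq').1
  have h4 := (hs' q hq).1
  have hanti : orient x y p q' q = -orient x y p q q' := by unfold orient; ring
  have h0 : orient x y p q q' = 0 := by linarith
  have habs := le_antisymm ((hs q' hq').2 h0) ((hs' q hq).2 (by linarith))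
  have hqS : q ∈ S := Finset.mem_of_mem_filter q hq
  have hqS' : q' ∈ S := Finset.mem_of_mem_filter q' hq'
  rcases abs_eq_abs.1 habs with h | h
  · exact hx hqS hqS' (by linarith)
  · exfalso
    by_cases hqp : x q - x p = 0
    · exact (orient_self_left p r ▸ h1.ne) (by rw [hx hqS (Finset.mem_of_mem_filter p hp)
        (sub_eq_zero.1 hqp)])
    · have hm : (x q - x p) * (orient x y p r q + orient x y p r q') = 0 := by
        unfold orient at *
        linear_combination (x r - x p) * h0 + ((x r - x p) * (y q - y p)
          - (y r - y p) * (x q - x p)) * h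
      rcases mul_eq_zero.1 hm with h | h
      · exact hqp h
      · linarith

/-- If `r` is the first point met by one of the two parallel lines through `p` and `q` as they
rotate counterclockwise from the direction `p q`, and it lies ahead on the one through `p`, then
`p`, `q` is the sweep start of that line. -/
lemma isSweepStart_of_slope (hx : Set.InjOn x S) {p q r : α} (hp : p ∈ S) (hq : q ∈ S)
    (hpq : p ≠ q)
    (hadj : ∀ s ∈ S, orient x y p q s = 0 → (x s - x p) / (x q - x p) ≤ 0 ∨
      1 ≤ (x s - x p) / (x q - x p)) {κ : ℝ}
    (hpos : ∀ s ∈ S, 0 < orient x y p q s →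
      (x s - x p) / (x q - x p) ≤ κ * orient x y p q s)
    (hneg : ∀ s ∈ S, orient x y p q s < 0 →
      κ * orient x y p q s ≤ (x s - x p) / (x q - x p) - 1)
    (hr : 0 < orient x y p q r)
    (hrκ : (x r - x p) / (x q - x p) = κ * orient x y p q r) :
    IsSweepStart x y p q (lineThrough x y S p r, rightSide x y S p r) := by
  have hd : x q - x p ≠ 0 := sub_ne_zero.2 fun h => hpq (hx hq hp h).symm
  set X : α → ℝ := fun s => (x s - x p) / (x q - x p) with hX
  set Y : α → ℝ := orient x y p q with hY
  have hcross : ∀ u s, orient x y p u s = X u * Y s - X s * Y u := fun u s => by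
    simp only [hX, hY, orient]
    field_simp
    ring
  have hprs : ∀ s, orient x y p r s = - (Y r * (X s - κ * Y s)) := fun s => by
    rw [hcross, show X r = κ * Y r from hrκ]; ring
  have hside : ∀ s ∈ rightSide x y S p r, s ∈ S ∧ 0 < X s - κ * Y s := fun s hs => by
    simp only [rightSide, Finset.mem_filter, hprs, neg_neg_iff_pos] at hs
    exact ⟨hs.1, (mul_pos_iff_of_pos_left hr).1 hs.2⟩
  have hXq : X q = 1 := div_self hd
  have hYq : Y q = 0 := orient_self_right p q
  refine ⟨left_mem_lineThrough hp, ?_, ?_, ?_⟩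
  · intro u hu hup s hs
    obtain ⟨-, hs⟩ := hside s hs
    simp only [lineThrough, Finset.mem_filter, hprs, neg_eq_zero, mul_eq_zero, hr.ne',
      false_or] at hu
    obtain ⟨huS, hu⟩ := hu
    have hYu : 0 < Y u := by
      rcases lt_trichotomy (Y u) 0 with h | h | h
      · have := hneg u huS h
        simp only [hX] at hu
        linarith
      · exfalso
        rw [h, mul_zero, sub_zero] at hu
        rcases div_eq_zero_iff.1 hu with h | h
        · exact hup (hx huS hp (sub_eq_zero.1 h))
        · exact hd h
      · exact h
    have : orient x y p u s = -(Y u * (X s - κ * Y s)) := by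
      rw [hcross, show X u = κ * Y u by linarith]; ring
    rw [this, neg_neg_iff_pos]
    exact mul_pos hYu hs
  · simp only [rightSide, Finset.mem_filter, hprs, hXq, hYq]
    exact ⟨hq, by linarith⟩
  · intro s hs
    obtain ⟨hsS, hs⟩ := hside s hs
    have hYs : Y s ≤ 0 := by
      by_contra! h
      have := hpos s hsS h
      simp only [hX] at hs
      linarith
    refine ⟨hYs, fun h0 => ?_⟩
    have h0' : Y s = 0 := h0
    rw [h0', mul_zero, sub_zero] at hs
    have h1 : 1 ≤ X s := (hadj s hsS h0).resolve_left (not_le.2 hs)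
    have : x s - x p = X s * (x q - x p) := by simp only [hX]; field_simp
    rw [this, abs_mul]
    exact le_mul_of_one_le_left (abs_nonneg _) (h1.trans (le_abs_self _))

lemma exists_isSweepStart (hx : Set.InjOn x S) {p q : α} (hp : p ∈ S) (hq : q ∈ S)
    (hpq : p ≠ q) (hncol : ∃ s ∈ S, orient x y p q s ≠ 0)
    (hadj : ∀ s ∈ S, orient x y p q s = 0 → (x s - x p) / (x q - x p) ≤ 0 ∨
      1 ≤ (x s - x p) / (x q - x p)) :
    ∃ e ∈ sidedLines x y S, e.2.Nonempty ∧
      (IsSweepStart x y p q e ∨ IsSweepStart x y q p e) := by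
  have hd : x q - x p ≠ 0 := sub_ne_zero.2 fun h => hpq (hx hq hp h).symm
  set X : α → ℝ := fun s => (x s - x p) / (x q - x p) with hX
  set Y : α → ℝ := orient x y p q with hY
  have hXswap : ∀ s, (x s - x q) / (x p - x q) = 1 - X s := fun s => by
    have : x p - x q ≠ 0 := fun h => hd (by linarith)
    simp only [hX]
    field_simp
    ring
  obtain ⟨s₀, hs₀, hs₀Y⟩ := hncol
  obtain ⟨r, hr, hmax⟩ := Finset.exists_max_image (S.filter fun s => Y s ≠ 0)
    (fun s => max (X s / Y s) ((X s - 1) / Y s)) ⟨s₀, Finset.mem_filter.2 ⟨hs₀, hs₀Y⟩⟩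
  simp only [Finset.mem_filter] at hr hmax
  set κ := max (X r / Y r) ((X r - 1) / Y r) with hκ
  have hpos : ∀ s ∈ S, 0 < Y s → X s ≤ κ * Y s := fun s hs h =>
    (div_le_iff₀ h).1 ((le_max_left _ _).trans (hmax s ⟨hs, h.ne'⟩))
  have hneg : ∀ s ∈ S, Y s < 0 → κ * Y s ≤ X s - 1 := fun s hs h =>
    (div_le_iff_of_neg h).1 ((le_max_right _ _).trans (hmax s ⟨hs, h.ne⟩))
  have hYr : orient x y q p r = -Y r := orient_swap p q r
  have hmem : ∀ {u v : α}, u ∈ S → orient x y u v r ≠ 0 →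
      (lineThrough x y S u r, rightSide x y S u r) ∈ sidedLines x y S := fun {u v} hu h => by
    refine Finset.mem_image.2 ⟨(u, r), ?_, rfl⟩
    simp only [Finset.mem_offDiag]
    refine ⟨hu, hr.1, ?_⟩
    rintro rfl
    exact h (orient_self_left _ _)
  rcases lt_or_gt_of_ne hr.2 with h | h
  · refine ⟨_, hmem (v := p) hq (by rw [hYr]; exact neg_ne_zero.2 hr.2), ?_⟩
    have hst : IsSweepStart x y q p (lineThrough x y S q r, rightSide x y S q r) := by
      refine isSweepStart_of_slope (κ := κ) hx hq hp hpq.symm ?_ ?_ ?_ ?_ ?_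
      · intro s hs h0
        rw [orient_swap p q s, neg_eq_zero] at h0
        rw [hXswap]
        rcases hadj s hs h0 with h | h
        · right; linarith
        · left; linarith
      · intro s hs h0
        rw [orient_swap p q s] at h0 ⊢
        rw [hXswap]
        have := hneg s hs (by simp only [hY]; linarith)
        simp only [hY] at this
        linarith
      · intro s hs h0
        rw [orient_swap p q s] at h0 ⊢
        rw [hXswap]
        have := hpos s hs (by simp only [hY]; linarith)
        simp only [hY] at this
        linarith
      · rw [hYr]; linarith
      · rw [hXswap, hYr]
        have : κ = (X r - 1) / Y r :=
          max_eq_right ((div_le_div_right_of_neg h).2 (by linarith))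
        rw [this, mul_neg, div_mul_cancel₀ _ hr.2]
        ring
    exact ⟨⟨_, hst.2.2.1⟩, Or.inr hst⟩
  · refine ⟨_, hmem (v := q) hp hr.2, ?_⟩
    have hst : IsSweepStart x y p q (lineThrough x y S p r, rightSide x y S p r) := by
      refine isSweepStart_of_slope (κ := κ) hx hp hq hpq hadj hpos hneg h ?_
      have : κ = X r / Y r := max_eq_left ((div_le_div_iff_of_pos_right h).2 (by linarith))
      rw [this, div_mul_cancel₀ _ hr.2]
    exact ⟨⟨_, hst.2.2.1⟩, Or.inl hst⟩

lemma exists_orient_ne_zero (hx : Set.InjOn x S)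
    (hS : ∃ a ∈ S, ∃ b ∈ S, ∃ c ∈ S, orient x y a b c ≠ 0) {p q : α} (hp : p ∈ S) (hq : q ∈ S)
    (hpq : p ≠ q) : ∃ s ∈ S, orient x y p q s ≠ 0 := by
  by_contra! h
  obtain ⟨a, ha, b, hb, c, hc, habc⟩ := hS
  have h1 : x q - x p ≠ 0 := sub_ne_zero.2 fun h => hpq (hx hq hp h).symm
  have := orient_mul_of_collinear (h a ha) (h b hb) c
  rw [h c hc, mul_zero] at this
  exact (mul_ne_zero habc h1) this

/-- Every pair of consecutive points on a spanned line gives rise to its own sided line with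
nonempty side. -/
lemma sum_card_sub_one_le (hx : Set.InjOn x S)
    (hS : ∃ a ∈ S, ∃ b ∈ S, ∃ c ∈ S, orient x y a b c ≠ 0) :
    ∑ t ∈ spannedLines x y S, (t.card - 1) ≤
      ((sidedLines x y S).filter fun e => e.2.Nonempty).card := by
  have hcard : ∀ t : Finset α, t ∈ spannedLines x y S →
      t.card - 1 ≤ (t.filter fun q => ∃ p ∈ t, x p < x q).card := fun t ht => by
    have hne : t.Nonempty := Finset.card_pos.1 (two_pos.trans_le (two_le_card_of_mem_spannedLines ht))
    obtain ⟨m, hm, hmin⟩ := Finset.exists_min_image t x hne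
    rw [← Finset.card_erase_of_mem hm]
    refine Finset.card_le_card fun q hq => ?_
    obtain ⟨hqm, hq⟩ := Finset.mem_erase.1 hq
    refine Finset.mem_filter.2 ⟨hq, m, hm, lt_of_le_of_ne (hmin q hq) fun h => hqm ?_⟩
    exact (hx (subset_of_mem_spannedLines ht hm) (subset_of_mem_spannedLines ht hq) h).symm
  refine (Finset.sum_le_sum hcard).trans ?_
  rw [← Finset.card_sigma]
  refine Finset.card_le_card_of_forall_subsingleton
    (fun a e => ∃ p ∈ a.1, x p < x a.2 ∧ (IsSweepStart x y p a.2 e ∨ IsSweepStart x y a.2 p e))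
    ?_ ?_
  · rintro ⟨t, q⟩ ha
    simp only [Finset.mem_sigma, Finset.mem_filter] at ha
    obtain ⟨ht, hq, p₀, hp₀, hlt₀⟩ := ha
    obtain ⟨p, hp, hmax⟩ := Finset.exists_max_image (t.filter fun r => x r < x q) x
      ⟨p₀, by simp [hp₀, hlt₀]⟩
    simp only [Finset.mem_filter] at hp hmax
    obtain ⟨hp, hlt⟩ := hp
    have hpS := subset_of_mem_spannedLines ht hp
    have hqS := subset_of_mem_spannedLines ht hq
    have hpq : p ≠ q := fun h => hlt.ne (congrArg x h)
    obtain ⟨e, he, hne, hst⟩ := exists_isSweepStart hx hpS hqS hpq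
      (exists_orient_ne_zero hx hS hpS hqS hpq) (y := y) fun s hs h0 => by
        have hd : 0 < x q - x p := sub_pos.2 hlt
        have hst : s ∈ t := by
          rw [← lineThrough_eq_of_mem_spannedLines hx ht hp hq hpq]
          exact Finset.mem_filter.2 ⟨hs, h0⟩
        rcases lt_or_ge (x s) (x q) with h | h
        · left
          exact div_nonpos_of_nonpos_of_nonneg (sub_nonpos.2 (hmax s ⟨hst, h⟩)) hd.le
        · right
          rw [le_div_iff₀ hd]
          linarith
    exact ⟨e, Finset.mem_filter.2 ⟨he, hne⟩, p, hp, hlt, hst⟩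
  · rintro e he ⟨t, q⟩ ⟨ha, p, hp, hlt, h⟩ ⟨t', q'⟩ ⟨ha', p', hp', hlt', h'⟩
    simp only [Finset.mem_sigma, Finset.mem_filter] at ha ha' he hp hp' hlt hlt' h h'
    have hpq : p = p' ∧ q = q' := by
      rcases h with h | h <;> rcases h' with h' | h'
      · exact h.unique hx he.1 h'
      · obtain ⟨rfl, rfl⟩ := h.unique hx he.1 h'
        exact absurd hlt hlt'.not_gt
      · obtain ⟨rfl, rfl⟩ := h.unique hx he.1 h'
        exact absurd hlt hlt'.not_gt
      · exact (h.unique hx he.1 h').symm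
    obtain ⟨rfl, rfl⟩ := hpq
    have hne : p ≠ q := fun h => hlt.ne (congrArg x h)
    have : t = t' := by
      rw [← lineThrough_eq_of_mem_spannedLines hx ha.1 hp ha.2.1 hne,
        lineThrough_eq_of_mem_spannedLines hx ha'.1 hp' ha'.2.1 hne]
    rw [this]

lemma lineThrough_empty_mem_sidedLines {p q : α} (hp : p ∈ S) (hq : q ∈ S) (hpq : p ≠ q)
    (h : (∀ s ∈ S, 0 ≤ orient x y p q s) ∨ ∀ s ∈ S, orient x y p q s ≤ 0) :
    (lineThrough x y S p q, ∅) ∈ sidedLines x y S := by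
  rcases h with h | h
  · refine Finset.mem_image.2 ⟨(p, q), by simp [hp, hq, hpq], ?_⟩
    exact Prod.ext rfl (Finset.filter_eq_empty_iff.2 fun s hs => not_lt.2 (h s hs))
  · refine Finset.mem_image.2 ⟨(q, p), by simp [hp, hq, hpq.symm], Prod.ext ?_ ?_⟩
    · exact Finset.filter_congr fun s _ => by rw [orient_swap p q s, neg_eq_zero]
    · refine Finset.filter_eq_empty_iff.2 fun s hs => ?_
      rw [orient_swap p q s, not_lt, neg_nonneg]
      exact h s hs

/-- `t` is a spanned line having no point of `S` strictly above it, with respect to `y`. -/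
def IsUpperHullLine (x y : α → ℝ) (S t : Finset α) : Prop :=
  ∃ p ∈ S, ∃ q ∈ S, p ≠ q ∧ t = lineThrough x y S p q ∧
    ∀ s ∈ S, (x q - x p) * orient x y p q s ≤ 0

/-- `t` is a spanned line having no point of `S` strictly below it, with respect to `y`. -/
def IsLowerHullLine (x y : α → ℝ) (S t : Finset α) : Prop :=
  ∃ p ∈ S, ∃ q ∈ S, p ≠ q ∧ t = lineThrough x y S p q ∧
    ∀ s ∈ S, 0 ≤ (x q - x p) * orient x y p q s

lemma IsUpperHullLine.mem_sidedLines (hx : Set.InjOn x S) {t : Finset α}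
    (h : IsUpperHullLine x y S t) : (t, ∅) ∈ sidedLines x y S := by
  obtain ⟨p, hp, q, hq, hpq, rfl, h⟩ := h
  refine lineThrough_empty_mem_sidedLines hp hq hpq ?_
  rcases lt_or_gt_of_ne fun h => hpq (hx hp hq h) with hlt | hlt
  · exact Or.inr fun s hs => by_contra fun h' =>
      (mul_pos (sub_pos.2 hlt) (not_le.1 h')).not_ge (h s hs)
  · exact Or.inl fun s hs => by_contra fun h' =>
      (mul_pos_of_neg_of_neg (sub_neg.2 hlt) (not_le.1 h')).not_ge (h s hs)

lemma IsLowerHullLine.mem_sidedLines (hx : Set.InjOn x S) {t : Finset α}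
    (h : IsLowerHullLine x y S t) : (t, ∅) ∈ sidedLines x y S := by
  obtain ⟨p, hp, q, hq, hpq, rfl, h⟩ := h
  refine lineThrough_empty_mem_sidedLines hp hq hpq ?_
  rcases lt_or_gt_of_ne fun h => hpq (hx hp hq h) with hlt | hlt
  · exact Or.inl fun s hs => by_contra fun h' =>
      (mul_neg_of_pos_of_neg (sub_pos.2 hlt) (not_le.1 h')).not_ge (h s hs)
  · exact Or.inr fun s hs => by_contra fun h' =>
      (mul_neg_of_neg_of_pos (sub_neg.2 hlt) (not_le.1 h')).not_ge (h s hs)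

lemma IsUpperHullLine.ne_of_isLowerHullLine (hx : Set.InjOn x S)
    (hS : ∃ a ∈ S, ∃ b ∈ S, ∃ c ∈ S, orient x y a b c ≠ 0) {t t' : Finset α}
    (h : IsUpperHullLine x y S t) (h' : IsLowerHullLine x y S t') : t ≠ t' := by
  obtain ⟨p, hp, q, hq, hpq, rfl, h⟩ := h
  obtain ⟨u, hu, v, hv, huv, rfl, h'⟩ := h'
  intro heq
  obtain ⟨s, hs, hs0⟩ := exists_orient_ne_zero hx hS hp hq hpq
  have h1 : x q - x p ≠ 0 := sub_ne_zero.2 fun h => hpq (hx hq hp h).symm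
  have h2 : x v - x u ≠ 0 := sub_ne_zero.2 fun h => huv (hx hv hu h).symm
  have hu' : u ∈ lineThrough x y S p q := heq ▸ left_mem_lineThrough hu
  have hv' : v ∈ lineThrough x y S p q := heq ▸ right_mem_lineThrough hv
  have hmul := orient_mul_of_collinear (Finset.mem_filter.1 hu').2 (Finset.mem_filter.1 hv').2 s
  have h3 : (x v - x u) ^ 2 * ((x q - x p) * orient x y p q s) =
      (x q - x p) ^ 2 * ((x v - x u) * orient x y u v s) := by
    linear_combination -(x v - x u) * (x q - x p) * hmul
  have h4 : (x v - x u) ^ 2 * ((x q - x p) * orient x y p q s) < 0 :=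
    mul_neg_of_pos_of_neg (by positivity) (lt_of_le_of_ne (h s hs) (mul_ne_zero h1 hs0))
  exact h4.not_ge (h3 ▸ mul_nonneg (sq_nonneg _) (h' s hs))

/-- An extreme point in direction `x` lies on an upper and on a lower hull line. -/
lemma exists_hullLines_of_extreme (hx : Set.InjOn x S) (hS : S.Nontrivial) {u : α} (hu : u ∈ S)
    (hext : (∀ s ∈ S, x u ≤ x s) ∨ ∀ s ∈ S, x s ≤ x u) :
    (∃ t, IsUpperHullLine x y S t ∧ u ∈ t) ∧ ∃ t, IsLowerHullLine x y S t ∧ u ∈ t := by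
  have hne : ∀ s ∈ S, s ≠ u → x s - x u ≠ 0 := fun s hs hsu =>
    sub_ne_zero.2 fun h => hsu (hx hs hu h)
  obtain ⟨w, hw, hwu⟩ := hS.exists_ne u
  have hne' : (S.erase u).Nonempty := ⟨w, Finset.mem_erase.2 ⟨hwu, hw⟩⟩
  have key : ∀ r ∈ S, r ≠ u → ∀ s ∈ S, s ≠ u → (x r - x u) * orient x y u r s =
      (x r - x u) ^ 2 * (x s - x u) *
        ((y s - y u) / (x s - x u) - (y r - y u) / (x r - x u)) := fun r hr hru s hs hsu => by
    have h1 := hne r hr hru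
    have h2 := hne s hs hsu
    unfold orient
    field_simp
  obtain ⟨r, hr, hmax⟩ := Finset.exists_max_image (S.erase u)
    (fun s => (y s - y u) / (x s - x u)) hne'
  obtain ⟨r', hr', hmin⟩ := Finset.exists_min_image (S.erase u)
    (fun s => (y s - y u) / (x s - x u)) hne'
  simp only [Finset.mem_erase] at hr hr' hmax hmin
  have hself : ∀ r, (x r - x u) * orient x y u r u = 0 := fun r => by
    rw [orient_self_left, mul_zero]
  rcases hext with hext | hext
  · refine ⟨⟨_, ⟨u, hu, r, hr.2, hr.1.symm, rfl, fun s hs => ?_⟩, left_mem_lineThrough hu⟩,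
      ⟨_, ⟨u, hu, r', hr'.2, hr'.1.symm, rfl, fun s hs => ?_⟩, left_mem_lineThrough hu⟩⟩
    · rcases eq_or_ne s u with rfl | hsu
      · rw [hself]
      · rw [key r hr.2 hr.1 s hs hsu]
        exact mul_nonpos_of_nonneg_of_nonpos
          (mul_nonneg (sq_nonneg _) (sub_nonneg.2 (hext s hs))) (sub_nonpos.2 (hmax s ⟨hsu, hs⟩))
    · rcases eq_or_ne s u with rfl | hsu
      · rw [hself]
      · rw [key r' hr'.2 hr'.1 s hs hsu]
        exact mul_nonneg
          (mul_nonneg (sq_nonneg _) (sub_nonneg.2 (hext s hs))) (sub_nonneg.2 (hmin s ⟨hsu, hs⟩))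
  · refine ⟨⟨_, ⟨u, hu, r', hr'.2, hr'.1.symm, rfl, fun s hs => ?_⟩, left_mem_lineThrough hu⟩,
      ⟨_, ⟨u, hu, r, hr.2, hr.1.symm, rfl, fun s hs => ?_⟩, left_mem_lineThrough hu⟩⟩
    · rcases eq_or_ne s u with rfl | hsu
      · rw [hself]
      · rw [key r' hr'.2 hr'.1 s hs hsu]
        exact mul_nonpos_of_nonpos_of_nonneg
          (mul_nonpos_of_nonneg_of_nonpos (sq_nonneg _) (sub_nonpos.2 (hext s hs)))
          (sub_nonneg.2 (hmin s ⟨hsu, hs⟩))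
    · rcases eq_or_ne s u with rfl | hsu
      · rw [hself]
      · rw [key r hr.2 hr.1 s hs hsu]
        exact mul_nonneg_of_nonpos_of_nonpos
          (mul_nonpos_of_nonneg_of_nonpos (sq_nonneg _) (sub_nonpos.2 (hext s hs)))
          (sub_nonpos.2 (hmax s ⟨hsu, hs⟩))

lemma three_le_card_empty_sidedLines (hx : Set.InjOn x S)
    (hS : ∃ a ∈ S, ∃ b ∈ S, ∃ c ∈ S, orient x y a b c ≠ 0) :
    3 ≤ ((sidedLines x y S).filter fun e => ¬ e.2.Nonempty).card := by
  have hnt : S.Nontrivial := by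
    obtain ⟨a, ha, b, hb, c, -, habc⟩ := hS
    refine ⟨a, ha, b, hb, ?_⟩
    rintro rfl
    simp [orient] at habc
  obtain ⟨u, hu, hmin⟩ := Finset.exists_min_image S x hnt.nonempty
  obtain ⟨v, hv, hmax⟩ := Finset.exists_max_image S x hnt.nonempty
  have huv : u ≠ v := by
    rintro rfl
    obtain ⟨w, hw, hwu⟩ := hnt.exists_ne u
    exact hwu (hx hw hu (le_antisymm (hmax w hw) (hmin w hw)))
  obtain ⟨⟨t₁, h₁, hu₁⟩, t₂, h₂, hu₂⟩ :=
    exists_hullLines_of_extreme (y := y) hx hnt hu (Or.inl hmin)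
  obtain ⟨⟨t₃, h₃, hv₃⟩, t₄, h₄, hv₄⟩ :=
    exists_hullLines_of_extreme (y := y) hx hnt hv (Or.inr hmax)
  have hmemU : ∀ t, IsUpperHullLine x y S t →
      (t, ∅) ∈ (sidedLines x y S).filter fun e => ¬ e.2.Nonempty := fun t ht =>
    Finset.mem_filter.2 ⟨ht.mem_sidedLines hx, by simp⟩
  have hmemL : ∀ t, IsLowerHullLine x y S t →
      (t, ∅) ∈ (sidedLines x y S).filter fun e => ¬ e.2.Nonempty := fun t ht =>
    Finset.mem_filter.2 ⟨ht.mem_sidedLines hx, by simp⟩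
  have h12 := h₁.ne_of_isLowerHullLine hx hS h₂
  have h14 := h₁.ne_of_isLowerHullLine hx hS h₄
  have h32 := h₃.ne_of_isLowerHullLine hx hS h₂
  rw [← Nat.lt_iff_add_one_le, Finset.two_lt_card]
  by_cases h13 : t₁ = t₃
  · have h24 : t₂ ≠ t₄ := by
      rintro rfl
      subst h13
      have hs₁ : t₁ ∈ spannedLines x y S := by
        obtain ⟨p, hp, q, hq, hpq, rfl, -⟩ := h₁
        exact lineThrough_mem_spannedLines hp hq hpq
      have hs₂ : t₂ ∈ spannedLines x y S := by
        obtain ⟨p, hp, q, hq, hpq, rfl, -⟩ := h₂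
        exact lineThrough_mem_spannedLines hp hq hpq
      exact h12 ((lineThrough_eq_of_mem_spannedLines hx hs₁ hu₁ hv₃ huv).symm.trans
        (lineThrough_eq_of_mem_spannedLines hx hs₂ hu₂ hv₄ huv))
    exact ⟨_, hmemU _ h₁, _, hmemL _ h₂, _, hmemL _ h₄, by simp [h12], by simp [h14],
      by simp [h24]⟩
  · exact ⟨_, hmemU _ h₁, _, hmemL _ h₂, _, hmemU _ h₃, by simp [h12], by simp [h13],
      by simp [h32.symm]⟩

/-- Dual form of Melchior's inequality. -/
theorem sum_card_spannedLines_add_three_le (hx : Set.InjOn x S)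
    (hS : ∃ a ∈ S, ∃ b ∈ S, ∃ c ∈ S, orient x y a b c ≠ 0) :
    ∑ t ∈ spannedLines x y S, t.card + 3 ≤ 3 * (spannedLines x y S).card := by
  have h1 := sum_card_sub_one_le hx hS
  have h2 := three_le_card_empty_sidedLines hx hS
  have h3 := card_sidedLines_le (y := y) hx
  have h4 := Finset.card_filter_add_card_filter_not (s := sidedLines x y S)
    (fun e => e.2.Nonempty)
  have h5 : ∑ t ∈ spannedLines x y S, t.card =
      ∑ t ∈ spannedLines x y S, (t.card - 1) + (spannedLines x y S).card := by
    rw [Finset.card_eq_sum_ones, ← Finset.sum_add_distrib]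
    refine Finset.sum_congr rfl fun t ht => ?_
    have := two_le_card_of_mem_spannedLines ht
    omega
  omega

/-- Counting pairs of points by the lines they span, weighted by Melchior's inequality. -/
theorem card_filter_spannedLines_le (hx : Set.InjOn x S)
    (hS : ∃ a ∈ S, ∃ b ∈ S, ∃ c ∈ S, orient x y a b c ≠ 0) :
    6 * (((spannedLines x y S).filter fun t => t.card = 3).card : ℤ) +
      14 * ((spannedLines x y S).filter fun t => t.card = 4).card + 6 ≤
        (S.card : ℤ) * (S.card - 1) := by
  have h1 : ∑ t ∈ spannedLines x y S, (t.card : ℤ) + 3 ≤ 3 * (spannedLines x y S).card := by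
    exact_mod_cast sum_card_spannedLines_add_three_le hx hS
  have hoff : ∀ t : Finset α, (t.offDiag.card : ℤ) = t.card * (t.card - 1) := fun t => by
    rw [Finset.offDiag_card, Nat.cast_sub (Nat.le_mul_self _)]
    push_cast
    ring
  have h2 : ∑ t ∈ spannedLines x y S, ((t.card : ℤ) * (t.card - 1)) = S.card * (S.card - 1) := by
    simp_rw [← hoff]
    exact_mod_cast sum_card_offDiag_spannedLines hx
  have h3 : ∑ t ∈ spannedLines x y S,
      (6 * (if t.card = 3 then 1 else 0) + 14 * (if t.card = 4 then 1 else 0) : ℤ) ≤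
      ∑ t ∈ spannedLines x y S, ((t.card : ℤ) * (t.card - 1) + 2 * (t.card - 3)) := by
    refine Finset.sum_le_sum fun t ht => ?_
    have h := two_le_card_of_mem_spannedLines ht
    by_cases h3 : t.card = 3
    · simp [h3]
    by_cases h4 : t.card = 4
    · simp [h4]
    · simp only [h3, h4, if_false]
      have : (2 : ℤ) ≤ t.card := by exact_mod_cast h
      nlinarith
  simp only [Finset.sum_add_distrib, ← Finset.mul_sum, Finset.sum_sub_distrib, Finset.sum_boole,
    Finset.sum_const, nsmul_eq_mul] at h3
  rw [h2] at h3
  linarith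

end PlanarPoints

section ProjectivePlane

open Module

variable {E : Type*} [AddCommGroup E] [Module ℝ E]

lemma eq_of_le_of_finrank_eq_one {p q : Submodule ℝ E} (hp : finrank ℝ p = 1)
    (hq : finrank ℝ q = 1) (h : q ≤ p) : q = p :=
  have : FiniteDimensional ℝ p := FiniteDimensional.of_finrank_pos (by omega)
  Submodule.eq_of_le_of_finrank_eq h (by omega)

lemma sup_eq_of_finrank {p q l : Submodule ℝ E} (hp : finrank ℝ p = 1) (hq : finrank ℝ q = 1)
    (hpq : p ≠ q) (hl : finrank ℝ l = 2) (hpl : p ≤ l) (hql : q ≤ l) : p ⊔ q = l := by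
  have : FiniteDimensional ℝ l := FiniteDimensional.of_finrank_pos (by omega)
  have hle : p ⊔ q ≤ l := sup_le hpl hql
  have : FiniteDimensional ℝ ↥(p ⊔ q) := Submodule.finiteDimensional_of_le hle
  refine Submodule.eq_of_le_of_finrank_le hle ?_
  have hlt : p < p ⊔ q := left_lt_sup.2 fun h => hpq (eq_of_le_of_finrank_eq_one hp hq h).symm
  have := Submodule.finrank_lt_finrank_of_lt hlt
  omega

lemma eq_of_two_points {p q l l' : Submodule ℝ E} (hp : finrank ℝ p = 1) (hq : finrank ℝ q = 1)
    (hpq : p ≠ q) (hl : finrank ℝ l = 2) (hl' : finrank ℝ l' = 2) (hpl : p ≤ l) (hql : q ≤ l)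
    (hpl' : p ≤ l') (hql' : q ≤ l') : l = l' :=
  (sup_eq_of_finrank hp hq hpq hl hpl hql).symm.trans (sup_eq_of_finrank hp hq hpq hl' hpl' hql')

/-- Finitely many points of the projective plane lie in an affine chart in which their first
coordinates are distinct. -/
lemma exists_chart (hE : finrank ℝ E = 3) (P : Finset (Submodule ℝ E))
    (hP : ∀ p ∈ P, finrank ℝ p = 1) (hnt : P.Nontrivial) :
    ∃ (u : Submodule ℝ E → E) (h g k : Dual ℝ E),
      (∀ p ∈ P, p = ℝ ∙ u p ∧ h (u p) = 1) ∧ Set.InjOn (fun p => g (u p)) P ∧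
      ∀ w, h w = 0 → g w = 0 → k w = 0 → w = 0 := by
  have : FiniteDimensional ℝ E := FiniteDimensional.of_finrank_pos (by omega)
  have hv : ∀ p : P, ∃ v : E, v ≠ 0 ∧ (p : Submodule ℝ E) = ℝ ∙ v := fun p => by
    obtain ⟨v, hv, hspan⟩ := finrank_eq_one_iff'.1 (hP p p.2)
    refine ⟨v, by simpa using hv, le_antisymm (fun w hw => ?_) (by simp)⟩
    obtain ⟨c, hc⟩ := hspan ⟨w, hw⟩
    exact Submodule.mem_span_singleton.2 ⟨c, congrArg Subtype.val hc⟩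
  choose v hv0 hv using hv
  obtain ⟨h, hh⟩ := exists_dual_forall_apply_ne_zero (K := ℝ) v hv0
  let u : Submodule ℝ E → E := fun p => if hp : p ∈ P then (h (v ⟨p, hp⟩))⁻¹ • v ⟨p, hp⟩ else 0
  have hu : ∀ p ∈ P, p = ℝ ∙ u p ∧ h (u p) = 1 := fun p hp => by
    have hne := hh ⟨p, hp⟩
    simp only [u, hp, dif_pos, map_smul, smul_eq_mul]
    refine ⟨?_, inv_mul_cancel₀ hne⟩
    rw [Submodule.span_singleton_smul_eq (inv_ne_zero hne).isUnit]
    exact hv ⟨p, hp⟩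
  have hinj : ∀ p ∈ P, ∀ q ∈ P, u p = u q → p = q := fun p hp q hq hpq => by
    rw [(hu p hp).1, (hu q hq).1, hpq]
  obtain ⟨g, hg⟩ := exists_dual_forall_apply_ne_zero (K := ℝ)
    (fun e : (P.offDiag : Finset _) => u e.1.1 - u e.1.2) fun ⟨⟨p, q⟩, he⟩ => by
      simp only [Finset.mem_offDiag] at he
      exact sub_ne_zero.2 fun h => he.2.2 (hinj p he.1 q he.2.1 h)
  have hginj : Set.InjOn (fun p => g (u p)) P := fun p hp q hq hpq => by
    by_contra hne
    refine hg ⟨(p, q), Finset.mem_offDiag.2 ⟨hp, hq, hne⟩⟩ ?_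
    simpa [sub_eq_zero] using hpq
  obtain ⟨p, hp, q, hq, hpq⟩ := hnt
  have hlt : h.ker ⊓ g.ker < h.ker := by
    refine lt_of_le_of_ne inf_le_left fun heq => ?_
    have hmem : u p - u q ∈ h.ker := by simp [(hu p hp).2, (hu q hq).2]
    rw [← heq] at hmem
    have : g (u p - u q) = 0 := hmem.2
    exact hpq (hginj hp hq (by simpa [sub_eq_zero] using this))
  have hker : finrank ℝ h.ker = 2 := by
    have hsurj : LinearMap.range h = ⊤ := LinearMap.range_eq_top.2
      (LinearMap.surjective fun h0 => by simpa [h0] using (hu p hp).2)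
    have := LinearMap.finrank_range_add_finrank_ker h
    rw [hsurj, finrank_top, finrank_self] at this
    omega
  have hK : finrank ℝ ↥(h.ker ⊓ g.ker) ≤ 1 := by
    have := Submodule.finrank_lt_finrank_of_lt hlt
    omega
  obtain ⟨w₀, hw₀⟩ := finrank_le_one_iff.1 hK
  obtain ⟨k, hk⟩ : ∃ k : Dual ℝ E, k w₀ = 0 → (w₀ : E) = 0 := by
    by_cases h0 : (w₀ : E) = 0
    · exact ⟨0, fun _ => h0⟩
    · obtain ⟨k, hk⟩ := exists_dual_forall_apply_ne_zero (K := ℝ) (fun _ : Unit => (w₀ : E))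
        fun _ => h0
      exact ⟨k, fun h => absurd h (hk ())⟩
  refine ⟨u, h, g, k, hu, hginj, fun w hhw hgw hkw => ?_⟩
  obtain ⟨c, hc⟩ := hw₀ ⟨w, hhw, hgw⟩
  have hc : c • (w₀ : E) = w := congrArg Subtype.val hc
  rw [← hc, map_smul, smul_eq_zero] at hkw
  rcases hkw with rfl | hkw
  · rw [← hc, zero_smul]
  · rw [← hc, hk hkw, smul_zero]

/-- In an affine chart, incidence with a line is given by the vanishing of `orient`. -/
lemma le_iff_orient_eq_zero {P : Finset (Submodule ℝ E)} {u : Submodule ℝ E → E}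
    {h g k : Dual ℝ E} (hu : ∀ p ∈ P, p = ℝ ∙ u p ∧ h (u p) = 1)
    (hg : Set.InjOn (fun p => g (u p)) P) (hker : ∀ w, h w = 0 → g w = 0 → k w = 0 → w = 0)
    {l : Submodule ℝ E} (hl : finrank ℝ l = 2) {p q r : Submodule ℝ E} (hp : p ∈ P) (hq : q ∈ P)
    (hpq : p ≠ q) (hpl : p ≤ l) (hql : q ≤ l) (hr : r ∈ P) :
    r ≤ l ↔ orient (fun p => g (u p)) (fun p => k (u p)) p q r = 0 := by
  have : FiniteDimensional ℝ l := FiniteDimensional.of_finrank_pos (by omega)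
  have hmem : ∀ s ∈ P, s ≤ l ↔ u s ∈ l := fun s hs => by
    conv_lhs => rw [(hu s hs).1]
    exact Submodule.span_singleton_le_iff_mem _ _
  have hd : g (u q) - g (u p) ≠ 0 := sub_ne_zero.2 fun h => hpq (hg hq hp h).symm
  rw [hmem p hp] at hpl
  rw [hmem q hq] at hql
  rw [hmem r hr]
  set c : ℝ := (g (u r) - g (u p)) / (g (u q) - g (u p)) with hc
  set w : E := u r - u p - c • (u q - u p) with hw
  have hhw : h w = 0 := by simp [hw, (hu p hp).2, (hu q hq).2, (hu r hr).2]
  have hgw : g w = 0 := by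
    simp only [hw, hc, map_sub, map_smul, smul_eq_mul]
    field_simp
    ring
  have hkw : (g (u q) - g (u p)) * k w =
      orient (fun p => g (u p)) (fun p => k (u p)) p q r := by
    simp only [hw, hc, orient, map_sub, map_smul, smul_eq_mul]
    field_simp
  have hur : u r = w + (u p + c • (u q - u p)) := by rw [hw]; abel
  have hpql : u p + c • (u q - u p) ∈ l := add_mem hpl (l.smul_mem _ (sub_mem hql hpl))
  rw [hur, Submodule.add_mem_iff_left _ hpql, ← hkw, mul_eq_zero, or_iff_right hd]
  refine ⟨fun hwl => ?_, fun hkw => hker w hhw hgw hkw ▸ l.zero_mem⟩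
  by_contra hkw0
  have hli : LinearIndependent ℝ ![(⟨u p, hpl⟩ : l), ⟨u q - u p, sub_mem hql hpl⟩, ⟨w, hwl⟩] := by
    rw [Fintype.linearIndependent_iff]
    intro a ha
    have ha : a 0 • u p + a 1 • (u q - u p) + a 2 • w = 0 := by
      simpa [Fin.sum_univ_three] using congrArg Subtype.val ha
    have h0 : a 0 = 0 := by
      simpa [hhw, (hu p hp).2, (hu q hq).2] using congrArg h ha
    have h1 : a 1 = 0 := by
      have := congrArg g ha
      simp only [h0, map_add, map_sub, map_smul, map_zero, smul_eq_mul, hgw, zero_mul, mul_zero,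
        zero_add, add_zero] at this
      exact (mul_eq_zero.1 this).resolve_right hd
    have h2 : a 2 = 0 := by
      have := congrArg k ha
      simp only [h0, h1, map_add, map_smul, map_zero, smul_eq_mul, zero_mul, zero_add] at this
      exact (mul_eq_zero.1 this).resolve_right hkw0
    intro i
    fin_cases i <;> assumption
  have := hli.fintype_card_le_finrank
  simp [hl] at this

end ProjectivePlane

theorem stmt1 (a b : ℕ) (P L : Finset (Submodule ℝ (Fin 3 → ℝ)))
    (hPne : P.Nonempty) (hLne : L.Nonempty)
    (hP : ∀ p ∈ P, IsProjPoint p) (hL : ∀ l ∈ L, IsProjLine l)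
    (hP3 : (P.filter fun p => pointDeg L p = 3).card = a)
    (hP4 : (P.filter fun p => pointDeg L p = 4).card = b)
    (hPall : ∀ p ∈ P, pointDeg L p = 3 ∨ pointDeg L p = 4)
    (hL3 : (L.filter fun l => lineDeg P l = 3).card = a)
    (hL4 : (L.filter fun l => lineDeg P l = 4).card = b)
    (hLall : ∀ l ∈ L, lineDeg P l = 3 ∨ lineDeg P l = 4) :
    -((a : ℤ) + (b : ℤ)) ^ 2 + 7 * (a : ℤ) + 15 * (b : ℤ) + 6 ≤ 0 := by
  have hcard : P.card = a + b := by
    rw [← hP3, ← hP4, ← Finset.card_union_of_disjoint]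
    · rw [← Finset.filter_or, Finset.filter_true_of_mem hPall]
    · exact Finset.disjoint_filter.2 fun p _ h3 h4 => by omega
  have hpts : ∀ l ∈ L, ∀ p, ∃ q ∈ P, q ≤ l ∧ q ≠ p := fun l hl p => by
    have h : 1 < (P.filter fun q => q ≤ l).card := by
      have := hLall l hl
      unfold lineDeg at this
      omega
    obtain ⟨q, hq, hqp⟩ := Finset.exists_mem_ne h p
    rw [Finset.mem_filter] at hq
    exact ⟨q, hq.1, hq.2, hqp⟩
  obtain ⟨p, hp⟩ := hPne
  obtain ⟨l₁, hl₁, l₂, hl₂, hl⟩ := Finset.one_lt_card.1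
    (show 1 < (L.filter fun l => p ≤ l).card by
      have := hPall p hp
      unfold pointDeg at this
      omega)
  rw [Finset.mem_filter] at hl₁ hl₂
  obtain ⟨q₁, hq₁, hq₁l, hq₁p⟩ := hpts l₁ hl₁.1 p
  obtain ⟨q₂, hq₂, hq₂l, hq₂p⟩ := hpts l₂ hl₂.1 p
  obtain ⟨u, h, g, k, hu, hg, hker⟩ := exists_chart (by simp) P hP ⟨p, hp, q₁, hq₁, hq₁p.symm⟩
  set x : Submodule ℝ (Fin 3 → ℝ) → ℝ := fun p => g (u p)
  set y : Submodule ℝ (Fin 3 → ℝ) → ℝ := fun p => k (u p)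
  have hncol : ∃ a ∈ P, ∃ b ∈ P, ∃ c ∈ P, orient x y a b c ≠ 0 := by
    refine ⟨p, hp, q₁, hq₁, q₂, hq₂, fun h0 => hl ?_⟩
    have hq₂l₁ := (le_iff_orient_eq_zero hu hg hker (hL l₁ hl₁.1) hp hq₁ hq₁p.symm hl₁.2 hq₁l
      hq₂).2 h0
    exact eq_of_two_points (hP p hp) (hP q₂ hq₂) hq₂p.symm (hL _ hl₁.1) (hL _ hl₂.1) hl₁.2 hq₂l₁
      hl₂.2 hq₂l
  have hspan : ∀ l ∈ L, (P.filter fun q => q ≤ l) ∈ spannedLines x y P := fun l hl => by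
    obtain ⟨q, hq, hql, -⟩ := hpts l hl p
    obtain ⟨r, hr, hrl, hrq⟩ := hpts l hl q
    convert lineThrough_mem_spannedLines (x := x) (y := y) hq hr hrq.symm using 1
    exact Finset.filter_congr fun s hs =>
      le_iff_orient_eq_zero hu hg hker (hL l hl) hq hr hrq.symm hql hrl hs
  have hle : ∀ n, (L.filter fun l => lineDeg P l = n).card ≤
      ((spannedLines x y P).filter fun t => t.card = n).card := fun n => by
    refine Finset.card_le_card_of_injOn (fun l => P.filter fun q => q ≤ l) ?_ ?_
    · intro l hl
      obtain ⟨hl, hn⟩ := Finset.mem_filter.1 hl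
      exact Finset.mem_filter.2 ⟨hspan l hl, hn⟩
    · intro l hl l' hl' heq
      have hl := (Finset.mem_filter.1 hl).1
      have hl' := (Finset.mem_filter.1 hl').1
      obtain ⟨q, hq, hql, -⟩ := hpts l hl p
      obtain ⟨r, hr, hrl, hrq⟩ := hpts l hl q
      have htrans : ∀ s ∈ P, s ≤ l → s ≤ l' := fun s hs hsl =>
        ((Finset.ext_iff.1 heq s).1 (Finset.mem_filter.2 ⟨hs, hsl⟩) |> Finset.mem_filter.1).2
      exact eq_of_two_points (hP q hq) (hP r hr) hrq.symm (hL l hl) (hL l' hl') hql hrl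
        (htrans q hq hql) (htrans r hr hrl)
  have hmain := card_filter_spannedLines_le hg hncol
  have ha : (a : ℤ) ≤ ((spannedLines x y P).filter fun t => t.card = 3).card := by
    exact_mod_cast hL3 ▸ hle 3
  have hb : (b : ℤ) ≤ ((spannedLines x y P).filter fun t => t.card = 4).card := by
    exact_mod_cast hL4 ▸ hle 4
  rw [hcard] at hmain
  push_cast at hmain
  nlinarith
end

section
/- For every n ≥ 1, every geometric (n_{3|4}) configuration has at most min(4n, ⌊(n² + 17n − 6)/8⌋) incidences. -/
/- Model of the real projective plane: a point is a 1-dimensional linear subspace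
of ℝ³ and a line is a 2-dimensional linear subspace of ℝ³; a point p is incident
to a line ℓ when p ≤ ℓ. -/

open scoped Classical

section Melchior

open Real Set

/-- The value at angle `θ` of the linear functional with coefficients `g`. -/
noncomputable def sinusoid (g : ℝ × ℝ) (θ : ℝ) : ℝ := g.1 * cos θ + g.2 * sin θ

lemma continuous_sinusoid (g : ℝ × ℝ) : Continuous (sinusoid g) := by
  unfold sinusoid; fun_prop

lemma sinusoid_add_pi (g : ℝ × ℝ) (θ : ℝ) : sinusoid g (θ + π) = -sinusoid g θ := by
  simp [sinusoid]; ring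

lemma sinusoid_sub_pi (g : ℝ × ℝ) (θ : ℝ) : sinusoid g (θ - π) = -sinusoid g θ := by
  simp [sinusoid]; ring

lemma sinusoid_add_int_mul (g : ℝ × ℝ) (θ : ℝ) (m : ℤ) :
    sinusoid g (θ + m * (2 * π)) = sinusoid g θ := by
  simp [sinusoid, cos_add_int_mul_two_pi, sin_add_int_mul_two_pi]

lemma sinusoid_toIcoMod (g : ℝ × ℝ) (θ : ℝ) :
    sinusoid g (toIcoMod two_pi_pos 0 θ) = sinusoid g θ := by
  have h := sinusoid_add_int_mul g (toIcoMod two_pi_pos 0 θ) (toIcoDiv two_pi_pos 0 θ)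
  rw [← h, ← zsmul_eq_mul, toIcoMod_add_toIcoDiv_zsmul]

/-- Two distinct sinusoids cannot agree at two angles less than `π` apart. -/
lemma sinusoid_eq_of_eq_of_eq {g h : ℝ × ℝ} {θ φ : ℝ} (hθφ : θ < φ) (hπ : φ < θ + π)
    (hθ : sinusoid g θ = sinusoid h θ) (hφ : sinusoid g φ = sinusoid h φ) : g = h := by
  have hs : 0 < sin (φ - θ) := sin_pos_of_pos_of_lt_pi (by linarith) (by linarith)
  rw [sin_sub] at hs
  unfold sinusoid at hθ hφ
  ext
  · have : (g.1 - h.1) * (sin φ * cos θ - cos φ * sin θ) = 0 := by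
      linear_combination sin φ * hθ - sin θ * hφ
    rcases mul_eq_zero.1 this with h0 | h0
    · linarith
    · linarith
  · have : (g.2 - h.2) * (sin φ * cos θ - cos φ * sin θ) = 0 := by
      linear_combination cos θ * hφ - cos φ * hθ
    rcases mul_eq_zero.1 this with h0 | h0
    · linarith
    · linarith

lemma subsingleton_sinusoid_eq {g h : ℝ × ℝ} (hgh : g ≠ h) (c : ℝ) :
    {θ | θ ∈ Ico c (c + π) ∧ sinusoid g θ = sinusoid h θ}.Subsingleton := by
  rintro θ ⟨hθ, hθ'⟩ φ ⟨hφ, hφ'⟩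
  rcases lt_trichotomy θ φ with hlt | heq | hlt
  · exact absurd (sinusoid_eq_of_eq_of_eq hlt (by linarith [hθ.1, hφ.2]) hθ' hφ') hgh
  · exact heq
  · exact absurd (sinusoid_eq_of_eq_of_eq hlt (by linarith [hφ.1, hθ.2]) hφ' hθ') hgh

lemma sinusoid_eq_two_pi_subset (g h : ℝ × ℝ) (c : ℝ) :
    {θ | θ ∈ Ico c (c + 2 * π) ∧ sinusoid g θ = sinusoid h θ} ⊆
      {θ | θ ∈ Ico c (c + π) ∧ sinusoid g θ = sinusoid h θ} ∪
      {θ | θ ∈ Ico (c + π) (c + π + π) ∧ sinusoid g θ = sinusoid h θ} := by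
  rintro θ ⟨⟨h1, h2⟩, h3⟩
  rcases lt_or_ge θ (c + π) with h4 | h4
  · exact Or.inl ⟨⟨h1, h4⟩, h3⟩
  · exact Or.inr ⟨⟨h4, by linarith⟩, h3⟩

lemma finite_sinusoid_eq {g h : ℝ × ℝ} (hgh : g ≠ h) (c : ℝ) :
    {θ | θ ∈ Ico c (c + 2 * π) ∧ sinusoid g θ = sinusoid h θ}.Finite :=
  (((subsingleton_sinusoid_eq hgh c).finite).union
    (subsingleton_sinusoid_eq hgh (c + π)).finite).subset (sinusoid_eq_two_pi_subset g h c)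

lemma ncard_sinusoid_eq_le {g h : ℝ × ℝ} (hgh : g ≠ h) (c : ℝ) :
    {θ | θ ∈ Ico c (c + 2 * π) ∧ sinusoid g θ = sinusoid h θ}.ncard ≤ 2 := by
  have h1 := (subsingleton_sinusoid_eq hgh c)
  have h2 := (subsingleton_sinusoid_eq hgh (c + π))
  refine (ncard_le_ncard (sinusoid_eq_two_pi_subset g h c) (h1.finite.union h2.finite)).trans
    ((ncard_union_le _ _).trans ?_)
  have := h1.finite.to_subtype
  have := h2.finite.to_subtype
  have := ncard_le_one_iff_subsingleton.2 h1
  have := ncard_le_one_iff_subsingleton.2 h2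
  lia

/-- The member `a` has the highest value in `S` and `b` the lowest value outside `S`, and the former
is at most the latter. -/
def IsGap {ι : Type*} (g : ι → ℝ × ℝ) (S : Finset ι) (a b : ι) (θ : ℝ) : Prop :=
  (∀ s ∈ S, sinusoid (g s) θ ≤ sinusoid (g a) θ) ∧ sinusoid (g a) θ ≤ sinusoid (g b) θ ∧
    ∀ r ∉ S, sinusoid (g b) θ ≤ sinusoid (g r) θ

lemma isClosed_isGap {ι : Type*} {g : ι → ℝ × ℝ} (S : Finset ι) (a b : ι) :
    IsClosed {θ | IsGap g S a b θ} := by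
  have hc : ∀ i j, IsClosed {θ | sinusoid (g i) θ ≤ sinusoid (g j) θ} := fun i j =>
    isClosed_le (continuous_sinusoid _) (continuous_sinusoid _)
  simp only [IsGap, ofPred_and, ofPred_forall]
  exact (isClosed_iInter fun s => isClosed_iInter fun _ => hc _ _).inter
    ((hc _ _).inter (isClosed_iInter fun r => isClosed_iInter fun _ => hc _ _))

section Arrangement

variable {ι : Type*} [Fintype ι] (g : ι → ℝ × ℝ)

/-- The number of members of the family whose value at `θ` is less than `y`. -/
noncomputable def numLT (θ y : ℝ) : ℕ := (Finset.univ.filter fun i => sinusoid (g i) θ < y).card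

/-- The number of members of the family whose value at `θ` is at most `y`. -/
noncomputable def numLE (θ y : ℝ) : ℕ := (Finset.univ.filter fun i => sinusoid (g i) θ ≤ y).card

/-- The number of members of the family whose value at `θ` equals `y`. -/
noncomputable def numEq (θ y : ℝ) : ℕ := (Finset.univ.filter fun i => sinusoid (g i) θ = y).card

/-- At least two members of the family take the value `y` at `θ`. -/
def IsTie (θ y : ℝ) : Prop := ∃ i j, i ≠ j ∧ sinusoid (g i) θ = y ∧ sinusoid (g j) θ = y

/-- The values of rank `j` and `j + 1` at `θ` are both equal to `y`. -/
def Covers (j : ℕ) (θ y : ℝ) : Prop := numLT g θ y < j ∧ j < numLE g θ y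

/-- The block of ranks at which the value `y` is attained at `θ` ends at `j` or starts at
`j + 1`. -/
def Ends (j : ℕ) (θ y : ℝ) : Prop := numLT g θ y = j ∨ numLE g θ y = j

/-- At `θ` there is a tie at `y` whose block of ranks ends at `j` or starts at `j + 1`. -/
def Touches (j : ℕ) (θ y : ℝ) : Prop := IsTie g θ y ∧ Ends g j θ y

lemma numLT_add_numEq (θ y : ℝ) : numLT g θ y + numEq g θ y = numLE g θ y := by
  unfold numLT numEq numLE
  rw [← Finset.card_union_of_disjoint, ← Finset.filter_or]
  · simp only [le_iff_lt_or_eq]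
  · rw [Finset.disjoint_filter]
    intro i _ h
    exact h.ne

lemma two_le_numEq_iff {θ y : ℝ} : 2 ≤ numEq g θ y ↔ IsTie g θ y := by
  unfold numEq IsTie
  rw [← Nat.lt_iff_add_one_le, Finset.one_lt_card_iff]
  simp only [Finset.mem_filter, Finset.mem_univ, true_and]
  grind

lemma numLE_le (θ y : ℝ) : numLE g θ y ≤ Fintype.card ι := Finset.card_le_univ _

lemma numLE_le_numLT {θ y z : ℝ} (h : y < z) : numLE g θ y ≤ numLT g θ z :=
  Finset.card_le_card (Finset.monotone_filter_right _ fun _ _ hi => lt_of_le_of_lt hi h)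

variable {g}

lemma Covers.isTie {j : ℕ} {θ y : ℝ} (h : Covers g j θ y) : IsTie g θ y := by
  rw [← two_le_numEq_iff]
  have := numLT_add_numEq g θ y
  have := h.1
  have := h.2
  lia

lemma Covers.unique {j : ℕ} {θ y z : ℝ} (h : Covers g j θ y) (h' : Covers g j θ z) : y = z := by
  have := h.1
  have := h.2
  have := h'.1
  have := h'.2
  rcases lt_trichotomy y z with hlt | heq | hlt
  · have := numLE_le_numLT g (θ := θ) hlt
    lia
  · exact heq
  · have := numLE_le_numLT g (θ := θ) hlt
    lia

lemma counts_congr {θ φ : ℝ} (h : ∀ i, sinusoid (g i) θ = sinusoid (g i) φ) :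
    numLT g θ = numLT g φ ∧ numLE g θ = numLE g φ ∧ IsTie g θ = IsTie g φ := by
  refine ⟨?_, ?_, ?_⟩ <;> funext y <;> simp only [numLT, numLE, IsTie, h]

lemma covers_add_int_mul {j : ℕ} {θ y : ℝ} (m : ℤ) :
    Covers g j (θ + m * (2 * π)) y ↔ Covers g j θ y := by
  obtain ⟨h1, h2, -⟩ := counts_congr (g := g) (fun i => sinusoid_add_int_mul (g i) θ m)
  simp only [Covers, h1, h2]

lemma touches_toIcoMod {j : ℕ} {θ y : ℝ} :
    Touches g j (toIcoMod two_pi_pos 0 θ) y ↔ Touches g j θ y := by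
  obtain ⟨h1, h2, h3⟩ := counts_congr (g := g) (fun i => sinusoid_toIcoMod (g i) θ)
  simp only [Touches, Ends, h1, h2, h3]

lemma exists_lower_set (v : ι → ℝ) {j : ℕ} (hj : j ≤ Fintype.card ι) :
    ∃ S : Finset ι, S.card = j ∧ ∀ s ∈ S, ∀ r ∉ S, v s ≤ v r := by
  induction j with
  | zero => exact ⟨∅, by simp⟩
  | succ j ih =>
    obtain ⟨S, hS, hSr⟩ := ih (by lia)
    have hne : Sᶜ.Nonempty := by
      rw [← Finset.card_pos, Finset.card_compl]
      lia
    obtain ⟨t, ht, htmin⟩ := Finset.exists_min_image Sᶜ v hne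
    rw [Finset.mem_compl] at ht
    refine ⟨insert t S, by rw [Finset.card_insert_of_notMem ht, hS], ?_⟩
    intro s hs r hr
    rw [Finset.mem_insert, not_or] at hr
    rcases Finset.mem_insert.1 hs with rfl | hs
    · exact htmin r (Finset.mem_compl.2 hr.2)
    · exact hSr s hs r hr.2

lemma IsGap.covers {S : Finset ι} {a b : ι} (ha : a ∈ S) (hb : b ∉ S) {θ : ℝ}
    (h : IsGap g S a b θ) (hab : sinusoid (g a) θ = sinusoid (g b) θ) :
    Covers g S.card θ (sinusoid (g a) θ) := by
  obtain ⟨h1, h2, h3⟩ := h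
  constructor
  · refine Finset.card_lt_card ⟨fun i hi => ?_, fun hs => ?_⟩
    · by_contra hiS
      have := h3 i hiS
      have := (Finset.mem_filter.1 hi).2
      linarith
    · exact lt_irrefl _ (Finset.mem_filter.1 (hs ha)).2
  · refine Finset.card_lt_card ⟨fun i hi => ?_, fun hs => hb ?_⟩
    · simpa using h1 i hi
    · exact hs (by simp [hab])

lemma IsGap.eq_of_covers {S : Finset ι} {a b : ι} {θ y : ℝ}
    (h : IsGap g S a b θ) (hc : Covers g S.card θ y) :
    sinusoid (g a) θ = sinusoid (g b) θ := by
  obtain ⟨h1, h2, h3⟩ := h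
  obtain ⟨hc1, hc2⟩ := hc
  refine le_antisymm h2 (not_lt.1 fun hlt => ?_)
  rcases lt_or_ge (sinusoid (g a) θ) y with hy | hy
  · refine hc1.not_ge (Finset.card_le_card fun i hi => ?_)
    simpa using (h1 i hi).trans_lt hy
  · refine hc2.not_ge (Finset.card_le_card fun i hi => ?_)
    by_contra hiS
    have := h3 i hiS
    have := (Finset.mem_filter.1 hi).2
    linarith

/-- If no tie meets the gap above rank `|S|` in the connected set `I`, then the two members bounding
this gap do not change in `I`. -/
lemma IsGap.of_isPreconnected {S : Finset ι} {a b : ι} (ha : a ∈ S) (hb : b ∉ S) {I : Set ℝ}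
    (hI : IsPreconnected I) {θ₀ : ℝ} (hθ₀ : θ₀ ∈ I) (h₀ : IsGap g S a b θ₀)
    (hC : ∀ θ ∈ I, ∀ y, ¬ Covers g S.card θ y) (hT : ∀ θ ∈ I, ∀ y, ¬ Touches g S.card θ y) :
    I ⊆ {θ | IsGap g S a b θ} := by
  set U : Set ℝ := {θ | (∀ s ∈ S.erase a, sinusoid (g s) θ < sinusoid (g a) θ) ∧
    sinusoid (g a) θ < sinusoid (g b) θ ∧
    ∀ r ∈ Sᶜ.erase b, sinusoid (g b) θ < sinusoid (g r) θ} with hU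
  have hUopen : IsOpen U := by
    have ho : ∀ i j, IsOpen {θ | sinusoid (g i) θ < sinusoid (g j) θ} := fun i j =>
      isOpen_lt (continuous_sinusoid _) (continuous_sinusoid _)
    simp only [hU, ofPred_and, ofPred_forall]
    exact (isOpen_biInter_finset fun s _ => ho _ _).inter
      ((ho _ _).inter (isOpen_biInter_finset fun r _ => ho _ _))
  have hUsub : U ⊆ {θ | IsGap g S a b θ} := by
    rintro θ ⟨h1, h2, h3⟩
    refine ⟨fun s hs => ?_, h2.le, fun r hr => ?_⟩
    · rcases eq_or_ne s a with rfl | hne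
      · exact le_rfl
      · exact (h1 s (Finset.mem_erase.2 ⟨hne, hs⟩)).le
    · rcases eq_or_ne r b with rfl | hne
      · exact le_rfl
      · exact (h3 r (Finset.mem_erase.2 ⟨hne, Finset.mem_compl.2 hr⟩)).le
  have hsub : ∀ θ ∈ I, IsGap g S a b θ → θ ∈ U := by
    intro θ hθ h
    have hlt : sinusoid (g a) θ < sinusoid (g b) θ :=
      lt_of_le_of_ne h.2.1 fun heq => hC θ hθ _ (h.covers ha hb heq)
    refine ⟨fun s hs => ?_, hlt, fun r hr => ?_⟩
    · obtain ⟨hsa, hs⟩ := Finset.mem_erase.1 hs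
      refine lt_of_le_of_ne (h.1 s hs) fun heq => hT θ hθ (sinusoid (g a) θ)
        ⟨⟨s, a, hsa, heq, rfl⟩, Or.inr ?_⟩
      unfold numLE
      congr 1
      ext i
      simp only [Finset.mem_filter, Finset.mem_univ, true_and]
      refine ⟨fun hi => ?_, fun hi => h.1 i hi⟩
      by_contra hiS
      have := h.2.2 i hiS
      linarith
    · obtain ⟨hrb, hr⟩ := Finset.mem_erase.1 hr
      rw [Finset.mem_compl] at hr
      refine lt_of_le_of_ne (h.2.2 r hr) fun heq => hT θ hθ (sinusoid (g b) θ)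
        ⟨⟨r, b, hrb, heq.symm, rfl⟩, Or.inl ?_⟩
      unfold numLT
      congr 1
      ext i
      simp only [Finset.mem_filter, Finset.mem_univ, true_and]
      refine ⟨fun hi => ?_, fun hi => (h.1 i hi).trans_lt hlt⟩
      by_contra hiS
      have := h.2.2 i hiS
      linarith
  refine (hI.subset_left_of_subset_union hUopen
    (isClosed_isGap (g := g) S a b).isOpen_compl ?_ ?_ ⟨θ₀, hθ₀, hsub θ₀ hθ₀ h₀⟩).trans hUsub
  · exact disjoint_compl_right.mono_left hUsub
  · intro θ hθ
    by_cases h : IsGap g S a b θ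
    · exact Or.inl (hsub θ hθ h)
    · exact Or.inr h

/-- Between two consecutive coverings of a gap there is a tie touching the gap. -/
lemma exists_touches_between (hg : g.Injective)
    (hnc : ∀ θ, ∃ i j, sinusoid (g i) θ ≠ sinusoid (g j) θ) {j : ℕ} (hj : 0 < j)
    (hjn : j < Fintype.card ι) {c d y z : ℝ} (hcd : c < d) (hc : Covers g j c y)
    (hd : Covers g j d z) (hC : ∀ θ ∈ Ioo c d, ∀ y, ¬ Covers g j θ y) :
    ∃ θ ∈ Ioo c d, ∃ y, Touches g j θ y := by
  by_contra! hT
  obtain ⟨θ₀, hθ₀⟩ := nonempty_Ioo.2 hcd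
  obtain ⟨S, rfl, hS⟩ := exists_lower_set (fun i => sinusoid (g i) θ₀) hjn.le
  obtain ⟨a, ha, hamax⟩ := Finset.exists_max_image S (fun i => sinusoid (g i) θ₀)
    (Finset.card_pos.1 hj)
  obtain ⟨b, hb, hbmin⟩ := Finset.exists_min_image Sᶜ (fun i => sinusoid (g i) θ₀)
    (by rw [← Finset.card_pos, Finset.card_compl]; lia)
  rw [Finset.mem_compl] at hb
  have h₀ : IsGap g S a b θ₀ :=
    ⟨hamax, hS a ha b hb, fun r hr => hbmin r (Finset.mem_compl.2 hr)⟩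
  have hgap := IsGap.of_isPreconnected ha hb isPreconnected_Ioo hθ₀ h₀ hC hT
  have hcl : Icc c d ⊆ {θ | IsGap g S a b θ} := by
    rw [← closure_Ioo hcd.ne]
    exact closure_minimal hgap (isClosed_isGap S a b)
  have hgc : IsGap g S a b c := hcl (left_mem_Icc.2 hcd.le)
  have hgd : IsGap g S a b d := hcl (right_mem_Icc.2 hcd.le)
  have hab : g a ≠ g b := hg.ne fun h => hb (h ▸ ha)
  rcases lt_or_ge d (c + π) with hdc | hdc
  · exact hab (sinusoid_eq_of_eq_of_eq hcd hdc (hgc.eq_of_covers hc) (hgd.eq_of_covers hd))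
  · obtain ⟨i, k, hik⟩ := hnc c
    obtain ⟨h1, h2, h3⟩ : IsGap g S a b (c + π) := hcl ⟨by linarith [pi_pos], hdc⟩
    simp only [sinusoid_add_pi, neg_le_neg_iff] at h1 h2 h3
    have heq := hgc.eq_of_covers hc
    have key : ∀ i, sinusoid (g i) c = sinusoid (g a) c := fun i => by
      by_cases hi : i ∈ S
      · exact le_antisymm (hgc.1 i hi) (h1 i hi)
      · exact (le_antisymm (h3 i hi) (hgc.2.2 i hi)).trans heq.symm
    exact hik ((key i).trans (key k).symm)

/-- In every open half-turn there is a tie for the highest value. -/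
lemma exists_top_tie (hnc : ∀ θ, ∃ i j, sinusoid (g i) θ ≠ sinusoid (g j) θ) (φ : ℝ) :
    ∃ θ ∈ Ioo φ (φ + π), ∃ y, IsTie g θ y ∧ numLE g θ y = Fintype.card ι := by
  by_contra! hT
  obtain ⟨i₀, j₀, hij⟩ := hnc φ
  have hφ : φ < φ + π := by linarith [pi_pos]
  obtain ⟨θ₀, hθ₀⟩ := nonempty_Ioo.2 hφ
  obtain ⟨a, -, ha⟩ := Finset.exists_max_image Finset.univ (fun i => sinusoid (g i) θ₀)
    ⟨i₀, by simp⟩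
  set K : Set ℝ := ⋂ i, {θ | sinusoid (g i) θ ≤ sinusoid (g a) θ} with hK
  set U : Set ℝ := ⋂ i ∈ Finset.univ.erase a, {θ | sinusoid (g i) θ < sinusoid (g a) θ} with hU
  have hKc : IsClosed K := isClosed_iInter fun i =>
    isClosed_le (continuous_sinusoid _) (continuous_sinusoid _)
  have hUo : IsOpen U := isOpen_biInter_finset fun i _ =>
    isOpen_lt (continuous_sinusoid _) (continuous_sinusoid _)
  have hUK : U ⊆ K := by
    intro θ hθ
    simp only [hU, hK, mem_iInter, mem_ofPred_eq] at hθ ⊢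
    intro i
    rcases eq_or_ne i a with rfl | hne
    · exact le_rfl
    · exact (hθ i (by simpa using hne)).le
  have hKU : ∀ θ ∈ Ioo φ (φ + π), θ ∈ K → θ ∈ U := by
    intro θ hθ hθK
    simp only [hU, hK, mem_iInter, mem_ofPred_eq] at hθK ⊢
    intro i hi
    refine lt_of_le_of_ne (hθK i) fun heq => hT θ hθ (sinusoid (g a) θ)
      ⟨i, a, by simpa using hi, heq, rfl⟩ ?_
    simp [numLE, hθK]
  have hsub : Ioo φ (φ + π) ⊆ U := by
    refine isPreconnected_Ioo.subset_left_of_subset_union hUo hKc.isOpen_compl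
      (disjoint_compl_right.mono_left hUK) (fun θ hθ => ?_)
      ⟨θ₀, hθ₀, hKU θ₀ hθ₀ (mem_iInter.2 fun i => ha i (Finset.mem_univ i))⟩
    by_cases h : θ ∈ K
    · exact Or.inl (hKU θ hθ h)
    · exact Or.inr h
  have hcl : Icc φ (φ + π) ⊆ K := by
    rw [← closure_Ioo hφ.ne]
    exact closure_minimal (hsub.trans hUK) hKc
  have key : ∀ i, sinusoid (g i) φ = sinusoid (g a) φ := fun i => by
    have h1 := mem_iInter.1 (hcl (left_mem_Icc.2 hφ.le)) i
    have h2 := mem_iInter.1 (hcl (right_mem_Icc.2 hφ.le)) i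
    simp only [mem_ofPred_eq, sinusoid_add_pi, neg_le_neg_iff] at h1 h2
    exact le_antisymm h1 h2
  exact hij ((key i₀).trans (key j₀).symm)

lemma finite_tie_angles (hg : g.Injective) (c : ℝ) :
    {θ | θ ∈ Ico c (c + 2 * π) ∧ ∃ y, IsTie g θ y}.Finite := by
  refine (finite_iUnion fun p : {p : ι × ι // p.1 ≠ p.2} =>
    finite_sinusoid_eq (hg.ne p.2) c).subset ?_
  rintro θ ⟨hθ, y, i, k, hik, hi, hk⟩
  exact mem_iUnion.2 ⟨⟨(i, k), hik⟩, hθ, hi.trans hk.symm⟩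

lemma exists_touches_after (hg : g.Injective)
    (hnc : ∀ θ, ∃ i j, sinusoid (g i) θ ≠ sinusoid (g j) θ) {j : ℕ} (hj : 0 < j)
    (hjn : j < Fintype.card ι) {c y : ℝ} (hc : Covers g j c y) :
    ∃ θ, c < θ ∧ (∃ z, Touches g j θ z) ∧ ∀ φ ∈ Ioc c θ, ∀ z, ¬ Covers g j φ z := by
  have hfin : {θ | θ ∈ Ioc c (c + 2 * π) ∧ ∃ z, Covers g j θ z}.Finite := by
    refine ((finite_tie_angles hg c).union (finite_singleton (c + 2 * π))).subset ?_
    rintro θ ⟨⟨h1, h2⟩, z, hz⟩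
    rcases h2.lt_or_eq with h2 | h2
    · exact Or.inl ⟨⟨h1.le, h2⟩, z, hz.isTie⟩
    · exact Or.inr h2
  obtain ⟨d, ⟨hd, z, hz⟩, hmin⟩ := exists_min_image _ id hfin
    ⟨c + 2 * π, ⟨by linarith [two_pi_pos], le_rfl⟩, y, by simpa using (covers_add_int_mul 1).2 hc⟩
  have hC : ∀ θ ∈ Ioo c d, ∀ w, ¬ Covers g j θ w := fun θ hθ w hw =>
    hθ.2.not_ge (hmin θ ⟨⟨hθ.1, hθ.2.le.trans hd.2⟩, w, hw⟩)
  obtain ⟨θ, hθ, hT⟩ := exists_touches_between hg hnc hj hjn hd.1 hc hz hC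
  exact ⟨θ, hθ.1, hT, fun φ hφ => hC φ ⟨hφ.1, hφ.2.trans_lt hθ.2⟩⟩

variable (g) in
/-- The ties of the family in one full turn. -/
def tieSet : Set (ℝ × ℝ) := {v | v.1 ∈ Ico 0 (2 * π) ∧ IsTie g v.1 v.2}

lemma finite_tieSet (hg : g.Injective) : (tieSet g).Finite := by
  refine (finite_iUnion fun p : {p : ι × ι // p.1 ≠ p.2} =>
    (finite_sinusoid_eq (hg.ne p.2) 0).image fun θ => (θ, sinusoid (g p.1.1) θ)).subset ?_
  rintro ⟨θ, y⟩ ⟨hθ, i, k, hik, hi, hk⟩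
  exact mem_iUnion.2 ⟨⟨(i, k), hik⟩, θ, ⟨by simpa using hθ, hi.trans hk.symm⟩, by simpa using hi⟩

lemma toIcoMod_mem_tieSet {θ y : ℝ} (h : IsTie g θ y) :
    (toIcoMod two_pi_pos 0 θ, y) ∈ tieSet g := by
  refine ⟨by simpa using toIcoMod_mem_Ico two_pi_pos 0 θ, ?_⟩
  rwa [(counts_congr (g := g) (fun i => sinusoid_toIcoMod (g i) θ)).2.2]

lemma sum_numEq_mul_le (hg : g.Injective) :
    ∑ v ∈ (finite_tieSet hg).toFinset, numEq g v.1 v.2 * (numEq g v.1 v.2 - 1) ≤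
      2 * (Fintype.card ι * (Fintype.card ι - 1)) := by
  set V := (finite_tieSet hg).toFinset with hV
  let R : ℝ × ℝ → ι × ι → Prop := fun v p => sinusoid (g p.1) v.1 = v.2 ∧ sinusoid (g p.2) v.1 = v.2
  have h1 : ∀ v, numEq g v.1 v.2 * (numEq g v.1 v.2 - 1) =
      (Finset.bipartiteAbove R (Finset.univ.filter fun p : ι × ι => p.1 ≠ p.2) v).card := by
    intro v
    unfold numEq
    rw [Nat.mul_sub_one, ← Finset.offDiag_card]
    congr 1
    ext p
    simp only [Finset.mem_offDiag, Finset.bipartiteAbove, Finset.mem_filter, Finset.mem_univ,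
      true_and, R]
    tauto
  have hcard : (Finset.univ.filter fun p : ι × ι => p.1 ≠ p.2).card =
      Fintype.card ι * (Fintype.card ι - 1) := by
    rw [Nat.mul_sub_one, ← Finset.card_univ, ← Finset.offDiag_card]
    congr 1
    ext p
    simp
  simp_rw [h1]
  rw [Finset.sum_card_bipartiteAbove_eq_sum_card_bipartiteBelow, mul_comm 2, ← hcard]
  refine Finset.sum_le_card_nsmul _ _ _ fun p hp => ?_
  have hp' : g p.1 ≠ g p.2 := hg.ne (Finset.mem_filter.1 hp).2
  refine le_trans ?_ (ncard_sinusoid_eq_le hp' 0)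
  rw [← ncard_coe_finset]
  refine ncard_le_ncard_of_injOn Prod.fst ?_ ?_ (finite_sinusoid_eq hp' 0)
  · intro v hv
    simp only [Finset.bipartiteBelow, Finset.coe_filter, mem_ofPred_eq, hV,
      Finite.mem_toFinset, R] at hv
    exact ⟨by simpa using hv.1.1, hv.2.1.trans hv.2.2.symm⟩
  · intro v hv w hw hvw
    simp only [Finset.bipartiteBelow, Finset.coe_filter, mem_ofPred_eq, R] at hv hw
    exact Prod.ext hvw (by rw [← hv.2.1, ← hw.2.1, hvw])

lemma card_covers_le_card_touches (hg : g.Injective)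
    (hnc : ∀ θ, ∃ i j, sinusoid (g i) θ ≠ sinusoid (g j) θ) {j : ℕ} (hj : 0 < j)
    (hjn : j < Fintype.card ι) :
    ((finite_tieSet hg).toFinset.filter fun v => Covers g j v.1 v.2).card ≤
      ((finite_tieSet hg).toFinset.filter fun v => Ends g j v.1 v.2).card := by
  have hex : ∀ v : ℝ × ℝ, ∃ w : ℝ × ℝ, Covers g j v.1 v.2 →
      v.1 < w.1 ∧ Touches g j w.1 w.2 ∧ ∀ φ ∈ Ioc v.1 w.1, ∀ z, ¬ Covers g j φ z := by
    intro v
    by_cases hv : Covers g j v.1 v.2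
    · obtain ⟨θ, h1, ⟨z, h2⟩, h3⟩ := exists_touches_after hg hnc hj hjn hv
      exact ⟨(θ, z), fun _ => ⟨h1, h2, h3⟩⟩
    · exact ⟨v, fun h => absurd h hv⟩
  choose F hF using hex
  refine Finset.card_le_card_of_injOn
    (fun v => (toIcoMod two_pi_pos 0 (F v).1, (F v).2)) ?_ ?_
  · intro v hv
    simp only [Finset.coe_filter, mem_ofPred_eq, Finite.mem_toFinset] at hv ⊢
    have hT := (hF v hv.2).2.1
    exact ⟨toIcoMod_mem_tieSet hT.1, (touches_toIcoMod.2 hT).2⟩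
  · intro v hv w hw hvw
    simp only [Finset.coe_filter, mem_ofPred_eq, Finite.mem_toFinset] at hv hw
    obtain ⟨hv1, hv2⟩ := hv
    obtain ⟨hw1, hw2⟩ := hw
    obtain ⟨a1, -, a3⟩ := hF v hv2
    obtain ⟨b1, -, b3⟩ := hF w hw2
    have h := (Prod.ext_iff.1 hvw).1
    simp only at h
    obtain ⟨m, hm⟩ := (toIcoMod_eq_toIcoMod two_pi_pos).1 h
    rw [zsmul_eq_mul] at hm
    have hθ : v.1 + m * (2 * π) = w.1 := by
      rcases lt_trichotomy (v.1 + m * (2 * π)) w.1 with hlt | heq | hlt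
      · refine absurd ((covers_add_int_mul (-m)).2 hw2) (a3 _ ⟨?_, ?_⟩ _) <;> push_cast <;> linarith
      · exact heq
      · exact absurd ((covers_add_int_mul m).2 hv2) (b3 _ ⟨hlt, by linarith⟩ _)
    have hm0 : m = 0 := by
      have h1 := hv1.1.1
      have h2 := hv1.1.2
      have h3 := hw1.1.1
      have h4 := hw1.1.2
      have h5 : (m : ℝ) < 1 := by
        by_contra! h
        nlinarith [two_pi_pos]
      have h6 : (-1 : ℝ) < m := by
        by_contra! h
        nlinarith [two_pi_pos]
      have h5' : m < 1 := by exact_mod_cast h5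
      have h6' : -1 < m := by exact_mod_cast h6
      lia
    have hθ' : v.1 = w.1 := by simpa [hm0] using hθ
    exact Prod.ext hθ' (hv2.unique (hθ' ▸ hw2))

/-- If every open half-turn contains a tie touching the gap `j`, then there are at least three such
ties in a full turn. -/
lemma three_le_card_ends (hg : g.Injective) {j : ℕ}
    (hj : ∀ φ, ∃ θ ∈ Ioo φ (φ + π), ∃ y, Touches g j θ y) :
    3 ≤ ((finite_tieSet hg).toFinset.filter fun v => Ends g j v.1 v.2).card := by
  obtain ⟨θ₁, -, y₁, ht₁⟩ := hj 0
  obtain ⟨θ₂, hθ₂, y₂, ht₂⟩ := hj θ₁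
  obtain ⟨θ₃, hθ₃, y₃, ht₃⟩ := hj (θ₁ + π)
  have hmem : ∀ {θ y}, Touches g j θ y → (toIcoMod two_pi_pos 0 θ, y) ∈
      (finite_tieSet hg).toFinset.filter fun v => Ends g j v.1 v.2 := by
    intro θ y ht
    rw [Finset.mem_filter, Finite.mem_toFinset]
    exact ⟨toIcoMod_mem_tieSet ht.1, (touches_toIcoMod.2 ht).2⟩
  have hne : ∀ {θ φ y z : ℝ}, θ < φ → φ < θ + 2 * π →
      (toIcoMod two_pi_pos 0 θ, y) ≠ (toIcoMod two_pi_pos 0 φ, z) := by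
    intro θ φ y z h1 h2 h
    obtain ⟨m, hm⟩ := (toIcoMod_eq_toIcoMod two_pi_pos).1 (Prod.ext_iff.1 h).1
    rw [zsmul_eq_mul] at hm
    have h5 : (m : ℝ) < 1 := by
      by_contra! h
      nlinarith [two_pi_pos]
    have h6 : (0 : ℝ) < m := by
      by_contra! h
      nlinarith [two_pi_pos]
    have h5' : m < 1 := by exact_mod_cast h5
    have h6' : 0 < m := by exact_mod_cast h6
    lia
  have := hθ₂.1
  have := hθ₂.2
  have := hθ₃.1
  have := hθ₃.2
  exact Finset.two_lt_card_iff.2 ⟨_, _, _, hmem ht₁, hmem ht₂, hmem ht₃,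
    hne (by linarith) (by linarith), hne (by linarith) (by linarith),
    hne (by linarith) (by linarith)⟩

lemma numLT_sub_pi_add_numLE (θ y : ℝ) :
    numLT g (θ - π) (-y) + numLE g θ y = Fintype.card ι := by
  have h := Finset.card_filter_add_card_filter_not (s := (Finset.univ : Finset ι))
    (fun i => sinusoid (g i) θ ≤ y)
  rw [Finset.card_univ] at h
  simp only [numLT, numLE, sinusoid_sub_pi, neg_lt_neg_iff]
  simp only [not_le] at h
  lia

/-- In every open half-turn there is a tie for the lowest value. -/
lemma exists_bottom_tie (hnc : ∀ θ, ∃ i j, sinusoid (g i) θ ≠ sinusoid (g j) θ) (φ : ℝ) :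
    ∃ θ ∈ Ioo φ (φ + π), ∃ y, IsTie g θ y ∧ numLT g θ y = 0 := by
  obtain ⟨θ, hθ, y, ⟨i, k, hik, hi, hk⟩, hy⟩ := exists_top_tie hnc (φ + π)
  refine ⟨θ - π, ⟨by linarith [hθ.1], by linarith [hθ.2]⟩, -y,
    ⟨i, k, hik, by rw [sinusoid_sub_pi, hi], by rw [sinusoid_sub_pi, hk]⟩, ?_⟩
  have := numLT_sub_pi_add_numLE (g := g) θ y
  lia

/-- **Melchior's inequality**, counting every tie once in each of two antipodal directions. -/
lemma sum_numEq_add_six_le (hg : g.Injective)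
    (hnc : ∀ θ, ∃ i j, sinusoid (g i) θ ≠ sinusoid (g j) θ) :
    ∑ v ∈ (finite_tieSet hg).toFinset, (numEq g v.1 v.2 - 1) + 6 ≤
      2 * (finite_tieSet hg).toFinset.card := by
  set V := (finite_tieSet hg).toFinset with hV
  set n := Fintype.card ι with hn
  have hn0 : 0 < n := by
    obtain ⟨i, -⟩ := hnc 0
    exact Fintype.card_pos_iff.2 ⟨i⟩
  have htouch : ∑ j ∈ Finset.range (n + 1),
      (V.filter fun v => Ends g j v.1 v.2).card = 2 * V.card := by
    simp only [Finset.card_filter]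
    rw [Finset.sum_comm, mul_comm]
    refine Finset.sum_const_nat fun v hv => ?_
    have ht : IsTie g v.1 v.2 := ((finite_tieSet hg).mem_toFinset.1 hv).2
    have h1 := (two_le_numEq_iff g).2 ht
    have h2 := numLT_add_numEq g v.1 v.2
    have h3 := numLE_le g v.1 v.2
    have : ((Finset.range (n + 1)).filter fun j => Ends g j v.1 v.2) =
        {numLT g v.1 v.2, numLE g v.1 v.2} := by
      ext j
      rw [Finset.mem_filter, Finset.mem_range, Finset.mem_insert, Finset.mem_singleton, Ends]
      lia
    rw [← Finset.card_filter, this, Finset.card_pair (by lia)]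
  have hcover : ∑ j ∈ Finset.Ioo 0 n, (V.filter fun v => Covers g j v.1 v.2).card =
      ∑ v ∈ V, (numEq g v.1 v.2 - 1) := by
    simp only [Finset.card_filter]
    rw [Finset.sum_comm]
    refine Finset.sum_congr rfl fun v _ => ?_
    have h2 := numLT_add_numEq g v.1 v.2
    have h3 := numLE_le g v.1 v.2
    have : ((Finset.Ioo 0 n).filter fun j => Covers g j v.1 v.2) =
        Finset.Ioo (numLT g v.1 v.2) (numLE g v.1 v.2) := by
      ext j
      rw [Finset.mem_filter, Finset.mem_Ioo, Finset.mem_Ioo, Covers]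
      lia
    rw [← Finset.card_filter, this, Nat.card_Ioo]
    lia
  have hsplit : Finset.range (n + 1) = insert 0 (insert n (Finset.Ioo 0 n)) := by
    ext j
    simp only [Finset.mem_range, Finset.mem_insert, Finset.mem_Ioo]
    lia
  rw [hsplit, Finset.sum_insert (by simp; lia), Finset.sum_insert (by simp)] at htouch
  have hbot := three_le_card_ends hg (j := 0) fun φ => by
    obtain ⟨θ, hθ, y, h1, h2⟩ := exists_bottom_tie hnc φ
    exact ⟨θ, hθ, y, h1, Or.inl h2⟩
  have htop := three_le_card_ends hg (j := n) fun φ => by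
    obtain ⟨θ, hθ, y, h1, h2⟩ := exists_top_tie hnc φ
    exact ⟨θ, hθ, y, h1, Or.inr h2⟩
  have hle := Finset.sum_le_sum fun j (hj : j ∈ Finset.Ioo 0 n) =>
    card_covers_le_card_touches hg hnc (Finset.mem_Ioo.1 hj).1 (Finset.mem_Ioo.1 hj).2
  rw [hcover] at hle
  lia

end Arrangement

end Melchior

section Coordinates

open Real

lemma line_eq_of_two_points {p q l m : Submodule ℝ (Fin 3 → ℝ)} (hp : IsProjPoint p)
    (hq : IsProjPoint q) (hl : IsProjLine l) (hm : IsProjLine m) (hpq : p ≠ q) (hpl : p ≤ l)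
    (hql : q ≤ l) (hpm : p ≤ m) (hqm : q ≤ m) : l = m := by
  unfold IsProjPoint at hp hq
  unfold IsProjLine at hl hm
  have hlt : p < p ⊔ q := lt_of_le_of_ne le_sup_left fun h => hpq
    (Submodule.eq_of_le_of_finrank_eq (h ▸ le_sup_right : q ≤ p) (by rw [hp, hq])).symm
  have h2 := Submodule.finrank_lt_finrank_of_lt hlt
  rw [hp] at h2
  have h3 : p ⊔ q = l := Submodule.eq_of_le_of_finrank_le (sup_le hpl hql) (by rw [hl]; exact h2)
  have h4 : p ⊔ q = m := Submodule.eq_of_le_of_finrank_le (sup_le hpm hqm) (by rw [hm]; exact h2)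
  exact h3.symm.trans h4

lemma exists_normal_of_isProjLine {l : Submodule ℝ (Fin 3 → ℝ)} (hl : IsProjLine l) :
    ∃ a b c : ℝ, (a ≠ 0 ∨ b ≠ 0 ∨ c ≠ 0) ∧
      ∀ q, q ∈ l ↔ a * q 0 + b * q 1 + c * q 2 = 0 := by
  unfold IsProjLine at hl
  have hlt : l < ⊤ := lt_top_iff_ne_top.2 fun h => by
    rw [h, finrank_top, Module.finrank_fin_fun] at hl
    lia
  obtain ⟨f, hf, hlf⟩ := Submodule.exists_le_ker_of_lt_top l hlt
  have hker : l = LinearMap.ker f := by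
    refine Submodule.eq_of_le_of_finrank_le hlf ?_
    have hlt' := Submodule.finrank_lt (s := LinearMap.ker f)
      (fun h => hf (LinearMap.ker_eq_top.1 h))
    rw [Module.finrank_fin_fun] at hlt'
    lia
  have hfq : ∀ q, f q = f (Pi.single 0 1) * q 0 + f (Pi.single 1 1) * q 1 +
      f (Pi.single 2 1) * q 2 := fun q => by
    have hqe : q = q 0 • Pi.single 0 1 + q 1 • Pi.single 1 1 + q 2 • Pi.single 2 1 := by
      ext i
      fin_cases i <;> simp
    conv_lhs => rw [hqe]
    simp only [map_add, map_smul, smul_eq_mul]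
    ring
  refine ⟨_, _, _, ?_, fun q => by rw [hker, LinearMap.mem_ker, hfq q]⟩
  by_contra! h
  refine hf (LinearMap.ext fun q => ?_)
  rw [hfq, h.1, h.2.1, h.2.2]
  simp

/-- In suitable coordinates, finitely many lines are graphs of linear functionals. -/
lemma exists_graph_coordinates (L : Finset (Submodule ℝ (Fin 3 → ℝ)))
    (hL : ∀ l ∈ L, IsProjLine l) :
    ∃ x : ℝ, ∀ l ∈ L, ∃ g : ℝ × ℝ, ∀ q,
      q ∈ l ↔ q 2 = g.1 * (q 0 - x * q 2) + g.2 * (q 1 - x ^ 2 * q 2) := by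
  choose! a b c h0 hq using fun l hl => exists_normal_of_isProjLine (hL l hl)
  have hfin : ∀ l ∈ L, {x : ℝ | a l * x + b l * x ^ 2 + c l = 0}.Finite := by
    intro l hl
    have hne : (Polynomial.C (b l) * Polynomial.X ^ 2 + Polynomial.C (a l) * Polynomial.X +
        Polynomial.C (c l)) ≠ 0 := by
      intro h
      have h2 := congrArg (fun p => p.coeff 2) h
      have h1 := congrArg (fun p => p.coeff 1) h
      have h3 := congrArg (fun p => p.coeff 0) h
      simp [Polynomial.coeff_X, Polynomial.coeff_C] at h1 h2 h3
      rcases h0 l hl with h | h | h <;> contradiction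
    refine (Polynomial.finite_setOfPred_isRoot hne).subset fun x hx => ?_
    have hx' : a l * x + b l * x ^ 2 + c l = 0 := hx
    simp [Polynomial.IsRoot]
    linarith
  obtain ⟨x, hx⟩ := (L.finite_toSet.biUnion hfin).exists_notMem
  refine ⟨x, fun l hl => ?_⟩
  have hD : a l * x + b l * x ^ 2 + c l ≠ 0 := fun h => hx (Set.mem_biUnion hl h)
  refine ⟨(-a l / (a l * x + b l * x ^ 2 + c l), -b l / (a l * x + b l * x ^ 2 + c l)),
    fun q => ?_⟩
  have e : -a l / (a l * x + b l * x ^ 2 + c l) * (q 0 - x * q 2) +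
      -b l / (a l * x + b l * x ^ 2 + c l) * (q 1 - x ^ 2 * q 2) =
      (-(a l * (q 0 - x * q 2)) - b l * (q 1 - x ^ 2 * q 2)) / (a l * x + b l * x ^ 2 + c l) := by
    ring
  rw [hq l hl, e, eq_div_iff hD]
  constructor <;> intro h <;> linarith

lemma exists_sinusoid_of_isProjPoint {p : Submodule ℝ (Fin 3 → ℝ)} (hp : IsProjPoint p) {x : ℝ}
    {L : Finset (Submodule ℝ (Fin 3 → ℝ))} {g : L → ℝ × ℝ}
    (hg : ∀ l : L, ∀ q, q ∈ l.1 ↔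
      q 2 = (g l).1 * (q 0 - x * q 2) + (g l).2 * (q 1 - x ^ 2 * q 2))
    (hpL : ∃ l ∈ L, p ≤ l) :
    ∃ θ y, ∀ l : L, p ≤ l ↔ sinusoid (g l) θ = y := by
  obtain ⟨q, hq0, hq⟩ := finrank_eq_one_iff'.1 hp
  have hq0' : (q : Fin 3 → ℝ) ≠ 0 := by simpa using hq0
  have hpq : ∀ l : Submodule ℝ (Fin 3 → ℝ), p ≤ l ↔ (q : Fin 3 → ℝ) ∈ l := by
    refine fun l => ⟨fun h => h q.2, fun h w hw => ?_⟩
    obtain ⟨c, hc⟩ := hq ⟨w, hw⟩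
    have hc' : c • (q : Fin 3 → ℝ) = w := congrArg Subtype.val hc
    rw [← hc']
    exact l.smul_mem c h
  set v : Fin 3 → ℝ := q.1
  set z : ℂ := ⟨v 0 - x * v 2, v 1 - x ^ 2 * v 2⟩ with hz
  have hre : v 0 - x * v 2 = ‖z‖ * cos z.arg := by rw [Complex.norm_mul_cos_arg]
  have him : v 1 - x ^ 2 * v 2 = ‖z‖ * sin z.arg := by rw [Complex.norm_mul_sin_arg]
  have hz0 : ‖z‖ ≠ 0 := by
    intro h0
    obtain ⟨l, hl, hpl⟩ := hpL
    have h2 := (hg ⟨l, hl⟩ v).1 ((hpq l).1 hpl)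
    rw [hre, him, h0] at h2
    rw [h0] at hre him
    have h2' : v 2 = 0 := by simpa using h2
    rw [h2'] at hre him
    refine hq0' (funext fun i => ?_)
    fin_cases i
    · simpa using hre
    · simpa using him
    · simpa using h2'
  refine ⟨z.arg, v 2 / ‖z‖, fun l => ?_⟩
  rw [hpq, hg, hre, him, sinusoid, eq_div_iff hz0]
  constructor <;> intro h <;> linarith

lemma exists_common_point {x θ y : ℝ} {L : Finset (Submodule ℝ (Fin 3 → ℝ))} {g : L → ℝ × ℝ}
    (hg : ∀ l : L, ∀ q, q ∈ l.1 ↔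
      q 2 = (g l).1 * (q 0 - x * q 2) + (g l).2 * (q 1 - x ^ 2 * q 2))
    (h : ∀ l : L, sinusoid (g l) θ = y) :
    ∃ p, IsProjPoint p ∧ ∀ l ∈ L, p ≤ l := by
  set v : Fin 3 → ℝ := ![cos θ + x * y, sin θ + x ^ 2 * y, y] with hv
  have hv0 : v ≠ 0 := by
    intro h0
    have h1 : cos θ + x * y = 0 := congrFun h0 0
    have h2 : sin θ + x ^ 2 * y = 0 := congrFun h0 1
    have h3 : y = 0 := congrFun h0 2
    simp only [h3, mul_zero, add_zero] at h1 h2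
    have := sin_sq_add_cos_sq θ
    simp [h1, h2] at this
  refine ⟨ℝ ∙ v, finrank_span_singleton hv0, fun l hl => ?_⟩
  rw [Submodule.span_singleton_le_iff_mem, hg ⟨l, hl⟩ v]
  have := h ⟨l, hl⟩
  simp only [sinusoid] at this
  simp [hv, this]

lemma incCount_eq_sum_pointDeg (P L : Finset (Submodule ℝ (Fin 3 → ℝ))) :
    incCount P L = ∑ p ∈ P, pointDeg L p := by
  simp only [incCount, pointDeg, Finset.card_filter, Finset.sum_product]

lemma numEq_eq_pointDeg {L : Finset (Submodule ℝ (Fin 3 → ℝ))} {g : L → ℝ × ℝ}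
    {p : Submodule ℝ (Fin 3 → ℝ)} {θ y : ℝ} (h : ∀ l : L, p ≤ l ↔ sinusoid (g l) θ = y) :
    numEq g θ y = pointDeg L p := by
  unfold numEq pointDeg
  rw [← Finset.card_map (Function.Embedding.subtype _)]
  congr 1
  ext l
  simp only [Finset.mem_map, Finset.mem_filter, Finset.mem_univ, true_and, ← h]
  exact ⟨fun ⟨m, hm, hml⟩ => hml ▸ ⟨m.2, hm⟩, fun ⟨h1, h2⟩ => ⟨⟨l, h1⟩, h2, rfl⟩⟩

/-- Melchior's inequality applied to a family of points and lines in which no point has degree less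
than two. -/
lemma sum_pointDeg_le (P L : Finset (Submodule ℝ (Fin 3 → ℝ)))
    (hP : ∀ p ∈ P, IsProjPoint p) (hL : ∀ l ∈ L, IsProjLine l) (hP2 : 2 ≤ P.card)
    (hPd : ∀ p ∈ P, 2 ≤ pointDeg L p) :
    2 * ∑ p ∈ P, (pointDeg L p * (pointDeg L p - 1) + 2 * (pointDeg L p - 1) - 4) + 12 ≤
      2 * (L.card * (L.card - 1)) := by
  obtain ⟨x, hx⟩ := exists_graph_coordinates L hL
  choose g hg using fun l : L => hx l.1 l.2
  have hinj : g.Injective := fun l m h => Subtype.ext (SetLike.ext fun q => by rw [hg, hg, h])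
  have htwo : ∀ p ∈ P, ∃ l ∈ L, ∃ m ∈ L, l ≠ m ∧ p ≤ l ∧ p ≤ m := by
    intro p hp
    obtain ⟨l, m, hl, hm, hlm⟩ := Finset.one_lt_card_iff.1 (hPd p hp)
    rw [Finset.mem_filter] at hl hm
    exact ⟨l, hl.1, m, hm.1, hlm, hl.2, hm.2⟩
  have hnc : ∀ θ, ∃ i j, sinusoid (g i) θ ≠ sinusoid (g j) θ := by
    by_contra! h
    obtain ⟨θ, hθ⟩ := h
    obtain ⟨p₀, hp₀⟩ : P.Nonempty := Finset.card_pos.1 (by lia)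
    obtain ⟨l₀, hl₀, -⟩ := htwo p₀ hp₀
    obtain ⟨c, hc, hcL⟩ := exists_common_point hg (fun l => hθ l ⟨l₀, hl₀⟩)
    obtain ⟨p, hp, hpc⟩ := Finset.exists_mem_ne hP2 c
    obtain ⟨l, hl, m, hm, hlm, hpl, hpm⟩ := htwo p hp
    exact hlm (line_eq_of_two_points (hP p hp) hc (hL l hl) (hL m hm) hpc hpl (hcL l hl) hpm
      (hcL m hm))
  have hsin : ∀ p ∈ P, ∃ θ y, ∀ l : L, p ≤ l ↔ sinusoid (g l) θ = y := fun p hp => by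
    obtain ⟨l, hl, -, -, -, hpl, -⟩ := htwo p hp
    exact exists_sinusoid_of_isProjPoint (hP p hp) hg ⟨l, hl, hpl⟩
  choose! θ y hθ using hsin
  set V := (finite_tieSet hinj).toFinset with hV
  let F : Submodule ℝ (Fin 3 → ℝ) × Bool → ℝ × ℝ := fun r =>
    (toIcoMod two_pi_pos 0 (θ r.1 + if r.2 then π else 0), if r.2 then -y r.1 else y r.1)
  have hF : ∀ r ∈ P ×ˢ (Finset.univ : Finset Bool), ∀ l : L,
      r.1 ≤ l ↔ sinusoid (g l) (F r).1 = (F r).2 := by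
    rintro ⟨p, b⟩ hr l
    rw [hθ p (Finset.mem_product.1 hr).1 l]
    cases b <;> simp [F, sinusoid_toIcoMod, sinusoid_add_pi]
  have hFnum : ∀ r ∈ P ×ˢ (Finset.univ : Finset Bool),
      numEq g (F r).1 (F r).2 = pointDeg L r.1 := fun r hr => numEq_eq_pointDeg (hF r hr)
  have hFV : (P ×ˢ (Finset.univ : Finset Bool)).image F ⊆ V := by
    intro v hv
    obtain ⟨r, hr, rfl⟩ := Finset.mem_image.1 hv
    rw [hV, Set.Finite.mem_toFinset]
    refine ⟨by simpa using toIcoMod_mem_Ico two_pi_pos 0 _, ?_⟩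
    rw [← two_le_numEq_iff, hFnum r hr]
    exact hPd _ (Finset.mem_product.1 hr).1
  have hFinj : Set.InjOn F (P ×ˢ (Finset.univ : Finset Bool) : Finset _) := by
    rintro ⟨p, b⟩ hr ⟨q, c⟩ hs h
    have hr' := Finset.mem_coe.1 hr
    have hs' := Finset.mem_coe.1 hs
    have hp := (Finset.mem_product.1 hr').1
    have hq := (Finset.mem_product.1 hs').1
    have hpq : p = q := by
      by_contra hne
      obtain ⟨l, hl, m, hm, hlm, hpl, hpm⟩ := htwo p hp
      have key : ∀ l ∈ L, p ≤ l → q ≤ l := fun l hl hpl =>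
        (hF _ hs' ⟨l, hl⟩).2 (h ▸ (hF _ hr' ⟨l, hl⟩).1 hpl)
      exact hlm (line_eq_of_two_points (hP p hp) (hP q hq) (hL l hl) (hL m hm) hne hpl
        (key l hl hpl) hpm (key m hm hpm))
    subst hpq
    have hodd : ∀ m : ℤ, m * (2 * π) ≠ π ∧ m * (2 * π) ≠ -π := by
      intro m
      constructor
      · intro hm
        have h1 : (m : ℝ) * 2 = 1 := mul_right_cancel₀ pi_ne_zero (by linarith)
        have h2 : m * 2 = 1 := by exact_mod_cast h1
        lia
      · intro hm
        have h1 : (m : ℝ) * 2 = -1 := mul_right_cancel₀ pi_ne_zero (by linarith)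
        have h2 : m * 2 = -1 := by exact_mod_cast h1
        lia
    obtain ⟨m, hm⟩ := (toIcoMod_eq_toIcoMod two_pi_pos).1 (Prod.ext_iff.1 h).1
    rw [zsmul_eq_mul] at hm
    obtain ⟨h1, h2⟩ := hodd m
    cases b <;> cases c
    · rfl
    · exact absurd (by simpa using hm.symm) h1
    · exact absurd (by simpa using hm.symm) h2
    · rfl
  let H : ℕ → ℕ := fun k => k * (k - 1) + 2 * (k - 1) - 4
  have hlow : 2 * ∑ p ∈ P, H (pointDeg L p) ≤ ∑ v ∈ V, H (numEq g v.1 v.2) := by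
    refine le_trans (le_of_eq ?_) (Finset.sum_le_sum_of_subset hFV)
    have e : ∑ r ∈ P ×ˢ (Finset.univ : Finset Bool), H (numEq g (F r).1 (F r).2) =
        ∑ r ∈ P ×ˢ (Finset.univ : Finset Bool), H (pointDeg L r.1) :=
      Finset.sum_congr rfl fun r hr => by rw [hFnum r hr]
    rw [Finset.sum_image hFinj, e, Finset.sum_product]
    simp [Finset.mul_sum]
  have hsplit : ∑ v ∈ V, H (numEq g v.1 v.2) + 4 * V.card =
      ∑ v ∈ V, numEq g v.1 v.2 * (numEq g v.1 v.2 - 1) + 2 * ∑ v ∈ V, (numEq g v.1 v.2 - 1) := by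
    rw [Finset.mul_sum, ← Finset.sum_add_distrib, mul_comm, ← smul_eq_mul, ← Finset.sum_const,
      ← Finset.sum_add_distrib]
    refine Finset.sum_congr rfl fun v hv => ?_
    have h2 := (two_le_numEq_iff g).2 ((finite_tieSet hinj).mem_toFinset.1 hv).2
    have h3 : 2 * 1 ≤ numEq g v.1 v.2 * (numEq g v.1 v.2 - 1) := Nat.mul_le_mul h2 (by lia)
    simp only [H]
    lia
  have hpairs := sum_numEq_mul_le hinj
  have hmel := sum_numEq_add_six_le hinj hnc
  rw [Fintype.card_coe] at hpairs
  lia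

end Coordinates

theorem stmt2 (n : ℕ) (hn : 1 ≤ n) (P L : Finset (Submodule ℝ (Fin 3 → ℝ)))
    (hP : ∀ p ∈ P, IsProjPoint p) (hL : ∀ l ∈ L, IsProjLine l)
    (hPcard : P.card = n) (hLcard : L.card = n)
    (hPd : ∀ p ∈ P, pointDeg L p = 3 ∨ pointDeg L p = 4)
    (hLd : ∀ l ∈ L, lineDeg P l = 3 ∨ lineDeg P l = 4) :
    incCount P L ≤ min (4 * n) ((n ^ 2 + 17 * n - 6) / 8) := by
  rw [incCount_eq_sum_pointDeg, le_min_iff]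
  constructor
  · rw [← hPcard, mul_comm, ← smul_eq_mul]
    exact Finset.sum_le_card_nsmul _ _ _ fun p hp => by rcases hPd p hp with h | h <;> lia
  · have hn3 : 3 ≤ n := by
      obtain ⟨p, hp⟩ : P.Nonempty := Finset.card_pos.1 (by lia)
      have h : pointDeg L p ≤ L.card := Finset.card_filter_le _ _
      rcases hPd p hp with h' | h' <;> lia
    have key := sum_pointDeg_le P L hP hL (by lia) fun p hp => by
      rcases hPd p hp with h | h <;> lia
    have hsum : ∑ p ∈ P, (pointDeg L p * (pointDeg L p - 1) + 2 * (pointDeg L p - 1) - 4) +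
        18 * n = 8 * ∑ p ∈ P, pointDeg L p := by
      rw [Finset.mul_sum, ← hPcard, mul_comm 18, ← smul_eq_mul, ← Finset.sum_const,
        ← Finset.sum_add_distrib]
      refine Finset.sum_congr rfl fun p hp => ?_
      rcases hPd p hp with h | h <;> simp [h]
    rw [hLcard] at key
    rw [Nat.le_div_iff_mul_le (by norm_num)]
    obtain ⟨m, rfl⟩ : ∃ m, n = m + 1 := ⟨n - 1, by lia⟩
    rw [Nat.add_sub_cancel] at key
    have hsq : (m + 1) ^ 2 = (m + 1) * m + (m + 1) := by ring
    lia
end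

section
/- There exists a geometric (43_4) configuration, i.e., a set P of 43 points and a set L of 43 lines in the real projective plane such that every point of P is incident to exactly 4 lines of L and every line of L is incident to exactly 4 points of P. -/
/- Model of the real projective plane: a point is a 1-dimensional linear subspace
of ℝ³ and a line is a 2-dimensional linear subspace of ℝ³; a point p is incident
to a line ℓ when p ≤ ℓ. -/

open scoped Classical

/-- The projective point spanned by an integer vector. -/
noncomputable def pointOfInt (v : Fin 3 → ℤ) : Submodule ℝ (Fin 3 → ℝ) :=
  Submodule.span ℝ {fun i => (v i : ℝ)}

/-- The linear functional with integer coefficients `w`. -/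
noncomputable def functionalOfInt (w : Fin 3 → ℤ) : Module.Dual ℝ (Fin 3 → ℝ) :=
  ∑ i, (w i : ℝ) • LinearMap.proj i

/-- The projective line with integer coefficient vector `w`. -/
noncomputable def lineOfInt (w : Fin 3 → ℤ) : Submodule ℝ (Fin 3 → ℝ) :=
  LinearMap.ker (functionalOfInt w)

/-- Two integer vectors with vanishing `2 × 2` minors. -/
abbrev Proportional (v w : Fin 3 → ℤ) : Prop :=
  v 0 * w 1 = v 1 * w 0 ∧ v 1 * w 2 = v 2 * w 1 ∧ v 2 * w 0 = v 0 * w 2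

/-- The integer dot product of `v` and `w` vanishes. -/
abbrev Incident (v w : Fin 3 → ℤ) : Prop :=
  v 0 * w 0 + v 1 * w 1 + v 2 * w 2 = 0

lemma functionalOfInt_apply (w : Fin 3 → ℤ) (x : Fin 3 → ℝ) :
    functionalOfInt w x = w 0 * x 0 + w 1 * x 1 + w 2 * x 2 := by
  simp [functionalOfInt, Fin.sum_univ_three]

lemma mem_lineOfInt {w : Fin 3 → ℤ} {x : Fin 3 → ℝ} :
    x ∈ lineOfInt w ↔ w 0 * x 0 + w 1 * x 1 + w 2 * x 2 = 0 := by
  rw [lineOfInt, LinearMap.mem_ker, functionalOfInt_apply]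

lemma pointOfInt_le_lineOfInt {v w : Fin 3 → ℤ} :
    pointOfInt v ≤ lineOfInt w ↔ Incident v w := by
  rw [pointOfInt, Submodule.span_singleton_le_iff_mem, mem_lineOfInt]
  norm_cast
  simp only [Incident, mul_comm]

lemma proportional_of_pointOfInt_eq {v w : Fin 3 → ℤ} (h : pointOfInt v = pointOfInt w) :
    Proportional v w := by
  have hv : (fun i => (v i : ℝ)) ∈ pointOfInt w := h ▸ Submodule.mem_span_singleton_self _
  obtain ⟨a, ha⟩ := Submodule.mem_span_singleton.1 hv
  have hc (i : Fin 3) : a * (w i : ℝ) = v i := congrFun ha i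
  refine ⟨?_, ?_, ?_⟩ <;> rify <;> simp only [← hc] <;> ring

lemma proportional_of_lineOfInt_eq {v w : Fin 3 → ℤ} (h : lineOfInt v = lineOfInt w) :
    Proportional v w := by
  have key (x : Fin 3 → ℝ) (hx : (v 0 : ℝ) * x 0 + v 1 * x 1 + v 2 * x 2 = 0) :
      (w 0 : ℝ) * x 0 + w 1 * x 1 + w 2 * x 2 = 0 :=
    mem_lineOfInt.1 (h ▸ mem_lineOfInt.2 hx)
  have h₂ := key ![(v 1 : ℝ), -v 0, 0] (by simp; ring)
  have h₀ := key ![0, (v 2 : ℝ), -v 1] (by simp; ring)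
  have h₁ := key ![-(v 2 : ℝ), 0, v 0] (by simp; ring)
  simp at h₀ h₁ h₂
  refine ⟨?_, ?_, ?_⟩ <;> rify <;> linarith

lemma isProjPoint_pointOfInt {v : Fin 3 → ℤ} (hv : v ≠ 0) : IsProjPoint (pointOfInt v) := by
  refine finrank_span_singleton fun h => hv ?_
  ext i
  simpa using congrFun h i

lemma isProjLine_lineOfInt {w : Fin 3 → ℤ} (hw : w ≠ 0) : IsProjLine (lineOfInt w) := by
  have hf : functionalOfInt w ≠ 0 := fun h => hw <| by
    ext i
    have hi : functionalOfInt w (Pi.single i 1) = 0 := by simp [h]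
    rw [functionalOfInt_apply] at hi
    fin_cases i <;> simpa using hi
  have := Module.Dual.finrank_ker_add_one_of_ne_zero hf
  rw [Module.finrank_fin_fun] at this
  unfold IsProjLine lineOfInt
  omega

/-- A finite incidence structure of pairwise non-proportional integer vectors is realized by
points and lines of the real projective plane with the same degrees. -/
lemma exists_configuration_of_int {n k : ℕ} (p l : Fin n → Fin 3 → ℤ)
    (hp₀ : ∀ i, p i ≠ 0) (hl₀ : ∀ i, l i ≠ 0)
    (hp : ∀ i j, Proportional (p i) (p j) → i = j)
    (hl : ∀ i j, Proportional (l i) (l j) → i = j)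
    (hpd : ∀ i, (Finset.univ.filter fun j => Incident (p i) (l j)).card = k)
    (hld : ∀ j, (Finset.univ.filter fun i => Incident (p i) (l j)).card = k) :
    ∃ P L : Finset (Submodule ℝ (Fin 3 → ℝ)),
      (∀ p ∈ P, IsProjPoint p) ∧ (∀ l ∈ L, IsProjLine l) ∧
      P.card = n ∧ L.card = n ∧
      (∀ p ∈ P, pointDeg L p = k) ∧ (∀ l ∈ L, lineDeg P l = k) := by
  have hpi : Function.Injective fun i => pointOfInt (p i) :=
    fun i j h => hp i j (proportional_of_pointOfInt_eq h)
  have hli : Function.Injective fun i => lineOfInt (l i) :=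
    fun i j h => hl i j (proportional_of_lineOfInt_eq h)
  refine ⟨Finset.univ.image fun i => pointOfInt (p i), Finset.univ.image fun i => lineOfInt (l i),
    ?_, ?_, ?_, ?_, ?_, ?_⟩
  · simpa using fun i => isProjPoint_pointOfInt (hp₀ i)
  · simpa using fun i => isProjLine_lineOfInt (hl₀ i)
  · simp [Finset.card_image_of_injective _ hpi]
  · simp [Finset.card_image_of_injective _ hli]
  · simp only [Finset.mem_image, Finset.mem_univ, true_and, forall_exists_index,
      forall_apply_eq_imp_iff]
    intro i
    rw [pointDeg, Finset.filter_image, Finset.card_image_of_injective _ hli, ← hpd i]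
    simp only [pointOfInt_le_lineOfInt]
  · simp only [Finset.mem_image, Finset.mem_univ, true_and, forall_exists_index,
      forall_apply_eq_imp_iff]
    intro j
    rw [lineDeg, Finset.filter_image, Finset.card_image_of_injective _ hpi, ← hld j]
    simp only [pointOfInt_le_lineOfInt]

/-- Homogeneous coordinates of the points of a `(43₄)` configuration. -/
def configurationPoints : Fin 43 → Fin 3 → ℤ :=
  ![![0, 1, -3], ![0, 1, 3], ![0, 3, -2], ![0, 3, 2], ![1, -3, -3],
    ![1, -3, -2], ![1, -3, 2], ![1, -3, 3], ![1, -1, -3], ![1, -1, -2],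
    ![1, -1, -1], ![1, -1, 0], ![1, -1, 1], ![1, -1, 2], ![1, -1, 3],
    ![1, 0, 0], ![1, 1, -3], ![1, 1, -2], ![1, 1, -1], ![1, 1, 0],
    ![1, 1, 1], ![1, 1, 2], ![1, 1, 3], ![1, 3, -3], ![1, 3, -2],
    ![1, 3, 2], ![1, 3, 3], ![2, -1, 0], ![2, 0, -3], ![2, 0, 3],
    ![2, 1, 0], ![3, -2, -3], ![3, -2, -1], ![3, -2, 1], ![3, -2, 3],
    ![3, -1, 0], ![3, 0, -1], ![3, 0, 1], ![3, 1, 0], ![3, 2, -3],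
    ![3, 2, -1], ![3, 2, 1], ![3, 2, 3]]

/-- Homogeneous coordinates of the lines of a `(43₄)` configuration. -/
def configurationLines : Fin 43 → Fin 3 → ℤ :=
  ![![0, 2, -3], ![0, 2, 3], ![0, 3, -1], ![0, 3, 1], ![1, -3, -3],
    ![1, -3, -1], ![1, -3, 1], ![1, -3, 3], ![1, -2, -3], ![1, -2, -1],
    ![1, -2, 1], ![1, -2, 3], ![1, -1, -1], ![1, -1, 1], ![1, 0, -1],
    ![1, 0, 0], ![1, 0, 1], ![1, 1, -1], ![1, 1, 1], ![1, 2, -3],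
    ![1, 2, -1], ![1, 2, 1], ![1, 2, 3], ![1, 3, -3], ![1, 3, -1],
    ![1, 3, 1], ![1, 3, 3], ![2, -3, 0], ![2, 0, -1], ![2, 0, 1],
    ![2, 3, 0], ![3, -3, -2], ![3, -3, 2], ![3, -1, -2], ![3, -1, 0],
    ![3, -1, 2], ![3, 0, -1], ![3, 0, 1], ![3, 1, -2], ![3, 1, 0],
    ![3, 1, 2], ![3, 3, -2], ![3, 3, 2]]

theorem stmt5 :
    ∃ P L : Finset (Submodule ℝ (Fin 3 → ℝ)),
      (∀ p ∈ P, IsProjPoint p) ∧ (∀ l ∈ L, IsProjLine l) ∧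
      P.card = 43 ∧ L.card = 43 ∧
      (∀ p ∈ P, pointDeg L p = 4) ∧ (∀ l ∈ L, lineDeg P l = 4) := by
  exact exists_configuration_of_int configurationPoints configurationLines
    (by decide +kernel) (by decide +kernel) (by decide +kernel) (by decide +kernel)
    (by decide +kernel) (by decide +kernel)
end

section
/- There exists a geometric (38_4) configuration, i.e., a set P of 38 points and a set L of 38 lines in the real projective plane such that every point of P is incident to exactly 4 lines of L and every line of L is incident to exactly 4 points of P. -/
/- Model of the real projective plane: a point is a 1-dimensional linear subspace
of ℝ³ and a line is a 2-dimensional linear subspace of ℝ³; a point p is incident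
to a line ℓ when p ≤ ℓ. -/

open scoped Classical

namespace QuarticConfig

/-- The element `a + b τ + (c + d τ) σ` of the ring `ℤ[τ, σ]`, where `τ² = 1 - τ` and
`σ² = 70 + 45 τ`. -/
structure Quartic where
  (a b c d : ℤ)
  deriving DecidableEq

namespace Quartic

def add (x y : Quartic) : Quartic := ⟨x.a + y.a, x.b + y.b, x.c + y.c, x.d + y.d⟩

def mul (x y : Quartic) : Quartic :=
  let e := x.c * y.c + x.d * y.d
  let f := x.c * y.d + x.d * y.c - x.d * y.d
  ⟨x.a * y.a + x.b * y.b + 70 * e + 45 * f,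
    x.a * y.b + x.b * y.a - x.b * y.b + 45 * e + 25 * f,
    x.a * y.c + x.b * y.d + x.c * y.a + x.d * y.b,
    x.a * y.d + x.b * y.c - x.b * y.d + (x.c * y.b + x.d * y.a - x.d * y.b)⟩

/-- The conjugate under `σ ↦ -σ`. -/
def conj (x : Quartic) : Quartic := ⟨x.a, x.b, -x.c, -x.d⟩

/-- The norm from `ℚ(τ, σ)` to `ℚ`. -/
def norm (x : Quartic) : ℤ :=
  let y := x.mul x.conj
  y.a * y.a - y.a * y.b - y.b * y.b

noncomputable def tau : ℝ := (√5 - 1) / 2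

noncomputable def sigma : ℝ := √(70 + 45 * tau)

theorem tau_sq : tau ^ 2 = 1 - tau := by
  have h : √5 ^ 2 = (5 : ℝ) := Real.sq_sqrt (by norm_num)
  unfold tau
  linear_combination h / 4

theorem tau_nonneg : 0 ≤ tau := by
  have h : (1 : ℝ) ≤ √5 := Real.one_le_sqrt.2 (by norm_num)
  unfold tau
  linarith

theorem sigma_sq : sigma ^ 2 = 70 + 45 * tau :=
  Real.sq_sqrt (by linarith [tau_nonneg])

/-- The real embedding of `ℤ[τ, σ]`. -/
noncomputable def toReal (x : Quartic) : ℝ := x.a + x.b * tau + (x.c + x.d * tau) * sigma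

theorem toReal_add (x y : Quartic) : (x.add y).toReal = x.toReal + y.toReal := by
  simp only [toReal, add]
  push_cast
  ring

theorem toReal_mul (x y : Quartic) : (x.mul y).toReal = x.toReal * y.toReal := by
  simp only [toReal, mul]
  push_cast
  linear_combination
    (-(x.b * y.b : ℝ) - (x.b * y.d + x.d * y.b) * sigma - x.d * y.d * (70 + 45 * tau)
      - 45 * (x.c * y.d + x.d * y.c - x.d * y.d)) * tau_sq
    - (x.c + x.d * tau) * (y.c + y.d * tau) * sigma_sq

theorem norm_eq_zero_of_toReal_eq_zero {x : Quartic} (h : x.toReal = 0) : x.norm = 0 := by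
  have hy : (x.mul x.conj).toReal = 0 := by rw [toReal_mul, h, zero_mul]
  have hc : (x.mul x.conj).c = 0 := by simp only [mul, conj]; ring
  have hd : (x.mul x.conj).d = 0 := by simp only [mul, conj]; ring
  unfold norm
  generalize x.mul x.conj = y at hy hc hd
  simp only [toReal, hc, hd] at hy
  push_cast at hy
  have : (y.a : ℝ) * y.a - y.a * y.b - y.b * y.b = 0 := by
    linear_combination (y.a - y.b - y.b * tau : ℝ) * hy + (y.b : ℝ) ^ 2 * tau_sq
  exact_mod_cast this

end Quartic

/-- Homogeneous coordinates over `ℤ[τ, σ]`. -/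
abbrev Coords := Quartic × Quartic × Quartic

def dot (v w : Coords) : Quartic :=
  ((v.1.mul w.1).add (v.2.1.mul w.2.1)).add (v.2.2.mul w.2.2)

noncomputable def realVec (v : Coords) : Fin 3 → ℝ :=
  ![v.1.toReal, v.2.1.toReal, v.2.2.toReal]

theorem realVec_dotProduct (v w : Coords) :
    realVec v ⬝ᵥ realVec w = (dot v w).toReal := by
  simp [realVec, dot, Quartic.toReal_add, Quartic.toReal_mul, dotProduct, Fin.sum_univ_three]

/-- The points: two projective images of a `(20_4)` configuration with five-fold symmetry, the
first without two of its lines and the second without two of its points, placed so that the eight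
points of degree three of the first lie on the eight lines of degree three of the second. -/
def pointCoords : List Coords :=
  [ (⟨10, 5, 3, -5⟩, ⟨-3, 4, 0, -1⟩, ⟨2, -1, -1, 1⟩),
    (⟨8, 6, -4, 6⟩, ⟨5, 0, -4, 5⟩, ⟨8, 1, 1, -1⟩),
    (⟨1, 7, 1, -4⟩, ⟨5, 15, -1, 0⟩, ⟨11, 2, 0, 1⟩),
    (⟨2, -1, -1, 0⟩, ⟨6, 2, -1, 1⟩, ⟨3, 1, 0, 0⟩),
    (⟨2, 9, -3, 3⟩, ⟨1, 7, -3, 4⟩, ⟨3, -4, 0, -1⟩),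
    (⟨0, -5, 3, -5⟩, ⟨-3, -6, 2, -3⟩, ⟨17, 14, 2, 1⟩),
    (⟨-2, -4, -4, 6⟩, ⟨5, -10, -2, 3⟩, ⟨23, 16, 4, -1⟩),
    (⟨-9, -3, 1, -4⟩, ⟨5, 5, 1, -2⟩, ⟨26, 17, 3, 1⟩),
    (⟨-6, -12, -2, 0⟩, ⟨12, -6, 0, 0⟩, ⟨21, 17, 3, 0⟩),
    (⟨-8, -1, -3, 3⟩, ⟨1, -3, -1, 2⟩, ⟨18, 11, 3, -1⟩),
    (⟨55, 5, 5, 0⟩, ⟨-15, -35, 1, -8⟩, ⟨50, 40, 6, 2⟩),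
    (⟨5, 15, -5, 10⟩, ⟨-10, -10, -6, 8⟩, ⟨115, 70, 14, 3⟩),
    (⟨-65, -40, 0, -15⟩, ⟨25, 15, 7, -6⟩, ⟨125, 80, 12, 9⟩),
    (⟨-14, -13, -3, 1⟩, ⟨9, 0, 0, 1⟩, ⟨14, 10, 2, 0⟩),
    (⟨-25, 10, 0, -5⟩, ⟨-5, 10, -2, 1⟩, ⟨30, 15, 3, 1⟩),
    (⟨90, 45, 7, 9⟩, ⟨-30, -20, -2, -4⟩, ⟨-95, -60, -10, -5⟩),
    (⟨40, 35, 7, -1⟩, ⟨-15, 10, -2, 1⟩, ⟨-35, -25, -5, 0⟩),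
    (⟨-30, -15, -3, -1⟩, ⟨20, 15, 3, 1⟩, ⟨-35, -25, -5, 0⟩),
    (⟨-30, -25, -3, -1⟩, ⟨10, 15, 3, 1⟩, ⟨-95, -60, -10, -5⟩),
    (⟨30, 35, 7, -1⟩, ⟨-25, 0, -2, 1⟩, ⟨-130, -85, -15, -5⟩),
    (⟨1, 0, 0, 0⟩, ⟨0, 0, 0, 0⟩, ⟨1, 0, 0, 0⟩),
    (⟨0, 0, 0, 0⟩, ⟨1, 0, 0, 0⟩, ⟨1, 0, 0, 0⟩),
    (⟨-1, 0, 0, 0⟩, ⟨0, 1, 0, 0⟩, ⟨1, 0, 0, 0⟩),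
    (⟨0, -1, 0, 0⟩, ⟨0, -1, 0, 0⟩, ⟨1, 0, 0, 0⟩),
    (⟨0, 1, 0, 0⟩, ⟨-1, 0, 0, 0⟩, ⟨1, 0, 0, 0⟩),
    (⟨2, 0, 0, 0⟩, ⟨0, 0, 0, 0⟩, ⟨7, 5, 1, 0⟩),
    (⟨0, 0, 0, 0⟩, ⟨2, 0, 0, 0⟩, ⟨7, 5, 1, 0⟩),
    (⟨-2, 0, 0, 0⟩, ⟨0, 2, 0, 0⟩, ⟨7, 5, 1, 0⟩),
    (⟨0, -2, 0, 0⟩, ⟨0, -2, 0, 0⟩, ⟨7, 5, 1, 0⟩),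
    (⟨0, 2, 0, 0⟩, ⟨-2, 0, 0, 0⟩, ⟨7, 5, 1, 0⟩),
    (⟨9, 3, 1, 0⟩, ⟨2, -1, 1, -1⟩, ⟨26, 17, 3, 1⟩),
    (⟨-2, 1, -1, 1⟩, ⟨8, 6, 0, 2⟩, ⟨26, 17, 3, 1⟩),
    (⟨5, 5, 1, 0⟩, ⟨-9, -3, -1, 0⟩, ⟨26, 17, 3, 1⟩),
    (⟨5, 5, 1, 0⟩, ⟨4, 3, 1, -1⟩, ⟨-26, -17, -3, -1⟩),
    (⟨-4, -3, -1, 1⟩, ⟨8, 6, 0, 2⟩, ⟨-26, -17, -3, -1⟩),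
    (⟨-8, -6, 0, -2⟩, ⟨2, -1, 1, -1⟩, ⟨-26, -17, -3, -1⟩),
    (⟨-2, 1, -1, 1⟩, ⟨-9, -3, -1, 0⟩, ⟨-26, -17, -3, -1⟩),
    (⟨9, 3, 1, 0⟩, ⟨-5, -5, -1, 0⟩, ⟨-26, -17, -3, -1⟩) ]

/-- The lines, as coefficient vectors of linear forms. -/
def lineCoords : List Coords :=
  [ (⟨-25, -35, 1, -8⟩, ⟨20, 55, 1, 7⟩, ⟨0, -15, -11, 13⟩),
    (⟨-135, -90, -18, -1⟩, ⟨-255, -180, -18, -31⟩, ⟨-25, -30, 18, -39⟩),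
    (⟨26, 15, 3, 1⟩, ⟨66, 35, 7, 3⟩, ⟨10, -3, 5, -7⟩),
    (⟨-1, -4, 0, 1⟩, ⟨5, 3, 3, -4⟩, ⟨6, 9, 3, -7⟩),
    (⟨-20, -10, 6, -8⟩, ⟨-5, -5, -9, 12⟩, ⟨60, -35, -1, -7⟩),
    (⟨25, -15, -3, 4⟩, ⟨-10, 15, 7, -11⟩, ⟨-25, -10, 8, -9⟩),
    (⟨35, 25, 3, -4⟩, ⟨40, 10, 8, -4⟩, ⟨-30, -40, 22, -26⟩),
    (⟨30, 0, 4, -2⟩, ⟨40, 45, -1, 13⟩, ⟨25, -40, -4, 7⟩),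
    (⟨15, 8, 2, 1⟩, ⟨38, 24, 4, 2⟩, ⟨6, 9, -1, 1⟩),
    (⟨-5, 15, 1, 2⟩, ⟨75, 50, 6, 7⟩, ⟨0, 25, -11, 13⟩),
    (⟨-55, -30, -8, -1⟩, ⟨-90, -75, -13, -1⟩, ⟨-25, -30, -2, 1⟩),
    (⟨-20, -10, -2, -4⟩, ⟨-100, -45, -7, -9⟩, ⟨-50, 20, -8, 14⟩),
    (⟨50, 50, 4, 8⟩, ⟨95, 40, 4, 13⟩, ⟨25, 0, -4, 7⟩),
    (⟨2, -1, -1, 1⟩, ⟨6, 7, 3, -3⟩, ⟨-8, 4, 2, -2⟩),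
    (⟨-17, -9, -1, -2⟩, ⟨-26, -22, -4, 0⟩, ⟨4, -12, 2, -4⟩),
    (⟨-12, -13, -1, -1⟩, ⟨-38, -15, -3, -3⟩, ⟨0, 4, -2, 2⟩),
    (⟨3, 4, 0, 1⟩, ⟨1, -5, 1, -2⟩, ⟨4, 0, 4, -6⟩),
    (⟨15, 6, 2, -1⟩, ⟨23, 17, 1, 4⟩, ⟨4, -8, 0, 2⟩),
    (⟨-12, -7, -1, -1⟩, ⟨-12, -7, -1, -1⟩, ⟨0, -2, 0, 0⟩),
    (⟨5, 2, 0, 1⟩, ⟨-12, -7, -1, -1⟩, ⟨0, -2, 0, 0⟩),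
    (⟨14, 10, 2, 0⟩, ⟨5, 2, 0, 1⟩, ⟨0, -2, 0, 0⟩),
    (⟨5, 2, 0, 1⟩, ⟨14, 10, 2, 0⟩, ⟨0, -2, 0, 0⟩),
    (⟨-12, -7, -1, -1⟩, ⟨5, 2, 0, 1⟩, ⟨0, -2, 0, 0⟩),
    (⟨-1, -1, 0, 0⟩, ⟨-1, -1, 0, 0⟩, ⟨0, -1, 0, 0⟩),
    (⟨0, 1, 0, 0⟩, ⟨-1, -1, 0, 0⟩, ⟨0, -1, 0, 0⟩),
    (⟨2, 0, 0, 0⟩, ⟨0, 1, 0, 0⟩, ⟨0, -1, 0, 0⟩),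
    (⟨0, 1, 0, 0⟩, ⟨2, 0, 0, 0⟩, ⟨0, -1, 0, 0⟩),
    (⟨-1, -1, 0, 0⟩, ⟨0, 1, 0, 0⟩, ⟨0, -1, 0, 0⟩),
    (⟨-5, -4, 0, -1⟩, ⟨3, 2, 0, 1⟩, ⟨-2, 0, 0, 0⟩),
    (⟨-7, -3, -1, 0⟩, ⟨-5, -4, 0, -1⟩, ⟨-2, 0, 0, 0⟩),
    (⟨2, 0, 0, 0⟩, ⟨-7, -3, -1, 0⟩, ⟨-2, 0, 0, 0⟩),
    (⟨7, 5, 1, 0⟩, ⟨2, 0, 0, 0⟩, ⟨-2, 0, 0, 0⟩),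
    (⟨3, 2, 0, 1⟩, ⟨7, 5, 1, 0⟩, ⟨-2, 0, 0, 0⟩),
    (⟨-7, -5, -1, 0⟩, ⟨-3, -2, 0, -1⟩, ⟨2, 0, 0, 0⟩),
    (⟨-2, 0, 0, 0⟩, ⟨-7, -5, -1, 0⟩, ⟨2, 0, 0, 0⟩),
    (⟨7, 3, 1, 0⟩, ⟨-2, 0, 0, 0⟩, ⟨2, 0, 0, 0⟩),
    (⟨5, 4, 0, 1⟩, ⟨7, 3, 1, 0⟩, ⟨2, 0, 0, 0⟩),
    (⟨-3, -2, 0, -1⟩, ⟨5, 4, 0, 1⟩, ⟨2, 0, 0, 0⟩) ]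

/-- For every point, the indices of the lines through it. -/
def linesThrough : List (List ℕ) :=
  [ [4, 6, 10, 14], [5, 7, 11, 15], [3, 6, 12, 16], [4, 7, 8, 17], [3, 5, 9, 13],
    [1, 11, 13, 22], [2, 12, 14, 35], [0, 8, 15, 27], [1, 2, 9, 16], [0, 10, 17, 23],
    [1, 5, 14, 17], [6, 13, 15, 37], [7, 14, 16, 21], [2, 3, 15, 17], [0, 4, 13, 16],
    [1, 3, 8, 10], [4, 9, 11, 34], [5, 10, 12, 36], [2, 6, 8, 11], [0, 7, 9, 12],
    [24, 26, 30, 34], [25, 27, 31, 35], [23, 26, 32, 36], [24, 27, 28, 37], [23, 25, 29, 33],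
    [19, 21, 31, 33], [20, 22, 32, 34], [18, 21, 28, 35], [19, 22, 29, 36], [18, 20, 30, 37],
    [19, 25, 34, 37], [20, 26, 33, 35], [18, 24, 33, 36], [19, 23, 28, 30], [20, 24, 29, 31],
    [21, 25, 30, 32], [22, 26, 28, 31], [18, 27, 29, 32] ]

def pointCoord (i : Fin 38) : Coords := pointCoords[i]

def lineCoord (j : Fin 38) : Coords := lineCoords[j]

/-- Whether point `i` lies on line `j`. -/
def inc (i j : Fin 38) : Bool := (linesThrough[i]).contains j.val

theorem dot_eq_zero_of_inc :
    ∀ i j, inc i j = true → dot (lineCoord j) (pointCoord i) = ⟨0, 0, 0, 0⟩ := by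
  decide +kernel

theorem norm_dot_ne_zero_of_not_inc :
    ∀ i j, inc i j = false → (dot (lineCoord j) (pointCoord i)).norm ≠ 0 := by
  decide +kernel

theorem card_lines_through :
    ∀ i, (Finset.univ.filter fun j => inc i j = true).card = 4 := by
  decide +kernel

theorem card_points_on :
    ∀ j, (Finset.univ.filter fun i => inc i j = true).card = 4 := by
  decide +kernel

theorem eq_of_inc_left : ∀ i i', (∀ j, inc i j = inc i' j) → i = i' := by
  decide +kernel

theorem eq_of_inc_right : ∀ j j', (∀ i, inc i j = inc i j') → j = j' := by
  decide +kernel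

noncomputable def point (i : Fin 38) : Submodule ℝ (Fin 3 → ℝ) :=
  Submodule.span ℝ {realVec (pointCoord i)}

noncomputable def line (j : Fin 38) : Submodule ℝ (Fin 3 → ℝ) :=
  LinearMap.ker (dotProductBilin ℝ ℝ (realVec (lineCoord j)))

theorem dotProduct_eq_zero_iff_inc (i j : Fin 38) :
    realVec (lineCoord j) ⬝ᵥ realVec (pointCoord i) = 0 ↔ inc i j = true := by
  rw [realVec_dotProduct]
  refine ⟨fun h => ?_, fun h => ?_⟩
  · by_contra hn
    exact norm_dot_ne_zero_of_not_inc i j (by simpa using hn)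
      (Quartic.norm_eq_zero_of_toReal_eq_zero h)
  · simp [dot_eq_zero_of_inc i j h, Quartic.toReal]

theorem point_le_line_iff (i j : Fin 38) : point i ≤ line j ↔ inc i j = true := by
  rw [point, line, Submodule.span_singleton_le_iff_mem, LinearMap.mem_ker,
    ← dotProduct_eq_zero_iff_inc]
  rfl

theorem point_injective : Function.Injective point := fun i i' h =>
  eq_of_inc_left i i' fun j => Bool.eq_iff_iff.2 <| by
    rw [← point_le_line_iff, ← point_le_line_iff, h]

theorem line_injective : Function.Injective line := fun j j' h =>
  eq_of_inc_right j j' fun i => Bool.eq_iff_iff.2 <| by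
    rw [← point_le_line_iff, ← point_le_line_iff, h]

theorem exists_not_inc_left : ∀ i, ∃ j, inc i j = false := by
  decide +kernel

theorem exists_not_inc_right : ∀ j, ∃ i, inc i j = false := by
  decide +kernel

theorem isProjPoint_point (i : Fin 38) : IsProjPoint (point i) := by
  refine finrank_span_singleton fun h => ?_
  obtain ⟨j, hj⟩ := exists_not_inc_left i
  simpa [h, hj] using dotProduct_eq_zero_iff_inc i j

theorem isProjLine_line (j : Fin 38) : IsProjLine (line j) := by
  obtain ⟨i, hi⟩ := exists_not_inc_right j
  set f := dotProductBilin ℝ ℝ (realVec (lineCoord j)) with hf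
  have hne : f ≠ 0 := fun h => by
    have h0 : f (realVec (pointCoord i)) = 0 := by rw [h]; rfl
    simpa [hi] using (dotProduct_eq_zero_iff_inc i j).1 h0
  have hrange := LinearMap.finrank_range_add_finrank_ker f
  rw [LinearMap.range_eq_top.2 (LinearMap.surjective hne), finrank_top] at hrange
  simp only [Module.finrank_self, Module.finrank_fin_fun] at hrange
  change Module.finrank ℝ (LinearMap.ker f) = 2
  omega

end QuarticConfig

open QuarticConfig in
theorem stmt6 :
    ∃ P L : Finset (Submodule ℝ (Fin 3 → ℝ)),
      (∀ p ∈ P, IsProjPoint p) ∧ (∀ l ∈ L, IsProjLine l) ∧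
      P.card = 38 ∧ L.card = 38 ∧
      (∀ p ∈ P, pointDeg L p = 4) ∧ (∀ l ∈ L, lineDeg P l = 4) := by
  refine ⟨Finset.univ.image point, Finset.univ.image line, ?_, ?_, ?_, ?_, ?_, ?_⟩
  · simpa using isProjPoint_point
  · simpa using isProjLine_line
  · simp [Finset.card_image_of_injective _ point_injective]
  · simp [Finset.card_image_of_injective _ line_injective]
  · simp only [Finset.mem_image, Finset.mem_univ, true_and, forall_exists_index,
      forall_apply_eq_imp_iff]
    intro i
    rw [pointDeg, Finset.filter_image, Finset.card_image_of_injective _ line_injective,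
      ← card_lines_through i]
    simp only [point_le_line_iff]
  · simp only [Finset.mem_image, Finset.mem_univ, true_and, forall_exists_index,
      forall_apply_eq_imp_iff]
    intro j
    rw [lineDeg, Finset.filter_image, Finset.card_image_of_injective _ point_injective,
      ← card_points_on j]
    simp only [point_le_line_iff]
end

section
/- There exists a geometric (20_4) configuration (P, L) together with partitions P = P₁ ⊔ P₂ and L = L₁ ⊔ L₂ such that |P₁| = |P₂| = |L₁| = |L₂| = 10, every point of P₁ is incident to exactly 3 lines of L₁ and every line of L₁ is incident to exactly 3 points of P₁, and every point of P₂ is incident to exactly 3 lines of L₂ and every line of L₂ is incident to exactly 3 points of P₂; that is, the (20_4) configuration splits into two geometric (10_3) configurations. -/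
/- Model of the real projective plane: a point is a 1-dimensional linear subspace
of ℝ³ and a line is a 2-dimensional linear subspace of ℝ³; a point p is incident
to a line ℓ when p ≤ ℓ. -/

open scoped Classical

open Real Matrix

/-- The ring `ℤ[φ]`, with `φ ^ 2 = φ + 1`. -/
abbrev GoldenInt : Type := QuadraticAlgebra ℤ 1 1

/-- The ring `ℤ[φ][ω]`, with `ω ^ 2 = (φ + 1) ω - 1`. -/
abbrev GoldenQuadInt : Type := QuadraticAlgebra GoldenInt (-1) ⟨1, 1⟩

namespace GoldenInt

/-- The evaluation of `ℤ[φ]` at a real root of `X ^ 2 - X - 1`. -/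
noncomputable def eval (r : ℝ) (hr : r ^ 2 = r + 1) : GoldenInt →+* ℝ where
  toFun x := x.re + x.im * r
  map_one' := by simp [QuadraticAlgebra.re_one, QuadraticAlgebra.im_one]
  map_zero' := by simp
  map_add' x y := by
    simp only [QuadraticAlgebra.re_add, QuadraticAlgebra.im_add]; push_cast; ring
  map_mul' x y := by
    simp only [QuadraticAlgebra.re_mul, QuadraticAlgebra.im_mul]; push_cast
    linear_combination (-(x.im : ℝ) * y.im) * hr

theorem eval_apply {r : ℝ} (hr : r ^ 2 = r + 1) (x : GoldenInt) :
    eval r hr x = x.re + x.im * r := rfl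

theorem eval_injective {r : ℝ} (hr : r ^ 2 = r + 1) (hirr : Irrational r) :
    Function.Injective (eval r hr) := by
  rw [injective_iff_map_eq_zero]
  intro x hx
  rw [eval_apply] at hx
  have him : x.im = 0 := by
    by_contra h
    refine (hirr.intCast_mul h).ne_int (-x.re) ?_
    push_cast
    linarith
  rw [him] at hx
  ext
  · simpa using hx
  · exact him

end GoldenInt

/-- The larger root of `X ^ 2 - (φ + 1) X + 1`. -/
noncomputable def omegaRoot : ℝ := (goldenRatio + 1 + √(3 * goldenRatio - 2)) / 2

theorem omegaRoot_sq : omegaRoot ^ 2 = (goldenRatio + 1) * omegaRoot - 1 := by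
  have hs : √(3 * goldenRatio - 2) ^ 2 = 3 * goldenRatio - 2 :=
    sq_sqrt (by linarith [one_lt_goldenRatio])
  unfold omegaRoot
  linear_combination hs / 4 - goldenRatio_sq / 4

namespace GoldenQuadInt

/-- The embedding of `ℤ[φ][ω]` in `ℝ` given by the golden ratio and `omegaRoot`. -/
noncomputable def toReal : GoldenQuadInt →+* ℝ where
  toFun x := GoldenInt.eval goldenRatio goldenRatio_sq x.re +
    GoldenInt.eval goldenRatio goldenRatio_sq x.im * omegaRoot
  map_one' := by simp [QuadraticAlgebra.re_one, QuadraticAlgebra.im_one]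
  map_zero' := by simp
  map_add' x y := by
    simp only [QuadraticAlgebra.re_add, QuadraticAlgebra.im_add, map_add]; ring
  map_mul' x y := by
    have h : GoldenInt.eval goldenRatio goldenRatio_sq ⟨1, 1⟩ = goldenRatio + 1 := by
      simp [GoldenInt.eval_apply, add_comm]
    simp only [QuadraticAlgebra.re_mul, QuadraticAlgebra.im_mul, map_add, map_mul, map_neg,
      map_one, h]
    linear_combination -(GoldenInt.eval goldenRatio goldenRatio_sq x.im *
      GoldenInt.eval goldenRatio goldenRatio_sq y.im) * omegaRoot_sq

theorem toReal_apply (x : GoldenQuadInt) :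
    toReal x = GoldenInt.eval goldenRatio goldenRatio_sq x.re +
      GoldenInt.eval goldenRatio goldenRatio_sq x.im * omegaRoot := rfl

/-- The norm form of `ℤ[φ][ω]` over `ℤ[φ]` becomes positive definite when `φ` is replaced by its
conjugate, so it is anisotropic. -/
theorem toReal_injective : Function.Injective toReal := by
  rw [injective_iff_map_eq_zero]
  intro x hx
  rw [toReal_apply] at hx
  have hn : x.re ^ 2 + x.re * x.im * ⟨1, 1⟩ + x.im ^ 2 = 0 := by
    apply GoldenInt.eval_injective goldenRatio_sq goldenRatio_irrational
    have h : GoldenInt.eval goldenRatio goldenRatio_sq ⟨1, 1⟩ = goldenRatio + 1 := by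
      simp [GoldenInt.eval_apply, add_comm]
    simp only [map_add, map_mul, map_pow, map_zero, h]
    set a := GoldenInt.eval goldenRatio goldenRatio_sq x.re
    set b := GoldenInt.eval goldenRatio goldenRatio_sq x.im
    linear_combination (a - b * omegaRoot + b * (goldenRatio + 1)) * hx + b ^ 2 * omegaRoot_sq
  have hc := congrArg (GoldenInt.eval goldenConj goldenConj_sq) hn
  have h : GoldenInt.eval goldenConj goldenConj_sq ⟨1, 1⟩ = goldenConj + 1 := by
    simp [GoldenInt.eval_apply, add_comm]
  simp only [map_add, map_mul, map_pow, map_zero, h] at hc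
  have hinj := GoldenInt.eval_injective goldenConj_sq goldenConj_irrational
  have h0 := goldenConj_neg
  have h1 := neg_one_lt_goldenConj
  set a := GoldenInt.eval goldenConj goldenConj_sq x.re with ha
  set b := GoldenInt.eval goldenConj goldenConj_sq x.im with hb
  have hsum : (1 - goldenConj) * (a ^ 2 + b ^ 2) + (1 + goldenConj) * (a + b) ^ 2 = 0 := by
    linear_combination 2 * hc
  have hab : a ^ 2 + b ^ 2 = 0 := by
    have h2 : 0 ≤ (1 + goldenConj) * (a + b) ^ 2 :=
      mul_nonneg (by linarith) (sq_nonneg _)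
    nlinarith [sq_nonneg a, sq_nonneg b]
  have ha0 : a = 0 := by nlinarith [sq_nonneg a, sq_nonneg b]
  have hb0 : b = 0 := by nlinarith [sq_nonneg a, sq_nonneg b]
  ext1
  · exact hinj (by rw [← ha, ha0]; simp)
  · exact hinj (by rw [← hb, hb0]; simp)

end GoldenQuadInt

/-- The projective point spanned by `v`. -/
noncomputable def projPoint (v : Fin 3 → ℝ) : Submodule ℝ (Fin 3 → ℝ) := ℝ ∙ v

/-- The projective line with equation `w ⬝ᵥ v = 0`. -/
noncomputable def projLine (w : Fin 3 → ℝ) : Submodule ℝ (Fin 3 → ℝ) :=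
  (dotProductBilin ℝ ℝ w).ker

theorem projPoint_le_projLine_iff {v w : Fin 3 → ℝ} :
    projPoint v ≤ projLine w ↔ w ⬝ᵥ v = 0 := by
  simp [projPoint, projLine, Submodule.span_singleton_le_iff_mem]

theorem isProjPoint_projPoint {v : Fin 3 → ℝ} (hv : v ≠ 0) : IsProjPoint (projPoint v) :=
  finrank_span_singleton hv

theorem isProjLine_projLine {w : Fin 3 → ℝ} (hw : w ≠ 0) : IsProjLine (projLine w) := by
  have hne : dotProductBilin ℝ ℝ w ≠ 0 := fun h =>
    hw (dotProduct_self_eq_zero.1 (by simpa using LinearMap.congr_fun h w))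
  have := Module.Dual.finrank_ker_add_one_of_ne_zero (f := dotProductBilin ℝ ℝ w) hne
  rw [Module.finrank_fin_fun] at this
  exact Nat.succ_injective this

namespace SplittingConfiguration

/-- Index set for four orbits of size five. -/
abbrev Index : Type := Fin 4 × Fin 5

/-- The first half of the index set. -/
abbrev firstHalf : Finset Index := Finset.univ.filter fun i => i.1 < 2

/-- The second half of the index set. -/
abbrev secondHalf : Finset Index := Finset.univ.filter fun i => 2 ≤ i.1

/-- A projective transformation of order five, acting on points. -/
def rotatePoint (v : Fin 3 → GoldenQuadInt) : Fin 3 → GoldenQuadInt :=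
  ![-v 1, v 0 + ⟨⟨-1, 1⟩, 0⟩ * v 1, v 2]

/-- The action on lines of the transformation `rotatePoint`. -/
def rotateLine (w : Fin 3 → GoldenQuadInt) : Fin 3 → GoldenQuadInt :=
  ![⟨⟨-1, 1⟩, 0⟩ * w 0 - w 1, w 0, w 2]

/-- Representatives of the four orbits of points. -/
def basePoint : Fin 4 → Fin 3 → GoldenQuadInt :=
  ![![⟨⟨1, 0⟩, ⟨0, 0⟩⟩, ⟨⟨0, 0⟩, ⟨0, 0⟩⟩, ⟨⟨1, 0⟩, ⟨0, 0⟩⟩],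
    ![⟨⟨0, 0⟩, ⟨-1, 0⟩⟩, ⟨⟨0, -1⟩, ⟨0, 2⟩⟩, ⟨⟨0, -1⟩, ⟨0, 0⟩⟩],
    ![⟨⟨1, 0⟩, ⟨-1, -1⟩⟩, ⟨⟨0, -1⟩, ⟨0, 1⟩⟩, ⟨⟨-1, -2⟩, ⟨1, 1⟩⟩],
    ![⟨⟨0, 0⟩, ⟨0, 0⟩⟩, ⟨⟨1, 0⟩, ⟨-1, -1⟩⟩, ⟨⟨-1, -1⟩, ⟨1, 0⟩⟩]]

/-- Representatives of the four orbits of lines. -/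
def baseLine : Fin 4 → Fin 3 → GoldenQuadInt :=
  ![![⟨⟨0, 0⟩, ⟨-1, 0⟩⟩, ⟨⟨-1, -3⟩, ⟨1, 1⟩⟩, ⟨⟨0, 0⟩, ⟨1, 0⟩⟩],
    ![⟨⟨-1, 0⟩, ⟨0, 0⟩⟩, ⟨⟨0, -2⟩, ⟨0, 0⟩⟩, ⟨⟨1, 0⟩, ⟨0, 0⟩⟩],
    ![⟨⟨0, -1⟩, ⟨0, 0⟩⟩, ⟨⟨-1, 1⟩, ⟨0, 0⟩⟩, ⟨⟨0, 1⟩, ⟨-2, -1⟩⟩],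
    ![⟨⟨-1, 0⟩, ⟨-1, 0⟩⟩, ⟨⟨1, 1⟩, ⟨0, -2⟩⟩, ⟨⟨1, 0⟩, ⟨-1, -1⟩⟩]]

/-- Homogeneous coordinates of the points. -/
def pointCoord (i : Index) : Fin 3 → GoldenQuadInt := rotatePoint^[i.2] (basePoint i.1)

/-- Homogeneous coordinates of the lines. -/
def lineCoord (j : Index) : Fin 3 → GoldenQuadInt := rotateLine^[j.2] (baseLine j.1)

/-- The point-line incidence relation in homogeneous coordinates. -/
abbrev Incident (i j : Index) : Prop :=
  lineCoord j 0 * pointCoord i 0 + lineCoord j 1 * pointCoord i 1 +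
    lineCoord j 2 * pointCoord i 2 = 0

/-- The points of the configuration. -/
noncomputable def point (i : Index) : Submodule ℝ (Fin 3 → ℝ) :=
  projPoint (GoldenQuadInt.toReal ∘ pointCoord i)

/-- The lines of the configuration. -/
noncomputable def line (j : Index) : Submodule ℝ (Fin 3 → ℝ) :=
  projLine (GoldenQuadInt.toReal ∘ lineCoord j)

theorem point_le_line_iff (i j : Index) : point i ≤ line j ↔ Incident i j := by
  rw [point, line, projPoint_le_projLine_iff, Incident, ← GoldenQuadInt.toReal_injective.eq_iff]
  simp [dotProduct, Fin.sum_univ_three]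

theorem comp_toReal_ne_zero {v : Fin 3 → GoldenQuadInt} (hv : v ≠ 0) :
    GoldenQuadInt.toReal ∘ v ≠ 0 := fun h =>
  hv (funext fun k => GoldenQuadInt.toReal_injective (by simpa using congrFun h k))

theorem isProjPoint_point (i : Index) : IsProjPoint (point i) :=
  isProjPoint_projPoint (comp_toReal_ne_zero (by revert i; decide +kernel))

theorem isProjLine_line (j : Index) : IsProjLine (line j) :=
  isProjLine_projLine (comp_toReal_ne_zero (by revert j; decide +kernel))

theorem point_injective : Function.Injective point := by
  intro i i' h
  have key : ∀ i i', (∀ j, Incident i j ↔ Incident i' j) → i = i' := by decide +kernel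
  exact key i i' fun j => by rw [← point_le_line_iff, ← point_le_line_iff, h]

theorem line_injective : Function.Injective line := by
  intro j j' h
  have key : ∀ j j', (∀ i, Incident i j ↔ Incident i j') → j = j' := by decide +kernel
  exact key j j' fun i => by rw [← point_le_line_iff, ← point_le_line_iff, h]

theorem pointDeg_image (s : Finset Index) (i : Index) :
    pointDeg (s.image line) (point i) = (s.filter fun j => Incident i j).card := by
  rw [pointDeg, Finset.filter_image, Finset.card_image_of_injective _ line_injective]
  simp only [point_le_line_iff]

theorem lineDeg_image (s : Finset Index) (j : Index) :
    lineDeg (s.image point) (line j) = (s.filter fun i => Incident i j).card := by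
  rw [lineDeg, Finset.filter_image, Finset.card_image_of_injective _ point_injective]
  simp only [point_le_line_iff]

end SplittingConfiguration

open SplittingConfiguration

theorem stmt7 :
    ∃ P L P₁ P₂ L₁ L₂ : Finset (Submodule ℝ (Fin 3 → ℝ)),
      (∀ p ∈ P, IsProjPoint p) ∧ (∀ l ∈ L, IsProjLine l) ∧
      P.card = 20 ∧ L.card = 20 ∧
      (∀ p ∈ P, pointDeg L p = 4) ∧ (∀ l ∈ L, lineDeg P l = 4) ∧
      Disjoint P₁ P₂ ∧ P₁ ∪ P₂ = P ∧ Disjoint L₁ L₂ ∧ L₁ ∪ L₂ = L ∧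
      P₁.card = 10 ∧ P₂.card = 10 ∧ L₁.card = 10 ∧ L₂.card = 10 ∧
      (∀ p ∈ P₁, pointDeg L₁ p = 3) ∧ (∀ l ∈ L₁, lineDeg P₁ l = 3) ∧
      (∀ p ∈ P₂, pointDeg L₂ p = 3) ∧ (∀ l ∈ L₂, lineDeg P₂ l = 3) := by
  have hdisj : Disjoint firstHalf secondHalf := by decide +kernel
  have hunion : firstHalf ∪ secondHalf = Finset.univ := by decide +kernel
  refine ⟨Finset.univ.image point, Finset.univ.image line, firstHalf.image point,
    secondHalf.image point, firstHalf.image line, secondHalf.image line, ?_⟩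
  simp only [Finset.forall_mem_image, pointDeg_image, lineDeg_image,
    Finset.card_image_of_injective _ point_injective,
    Finset.card_image_of_injective _ line_injective,
    Finset.disjoint_image point_injective, Finset.disjoint_image line_injective,
    ← Finset.image_union, hunion]
  refine ⟨fun i _ => isProjPoint_point i, fun j _ => isProjLine_line j, ?_, ?_, ?_, ?_, hdisj,
    trivial, hdisj, trivial, ?_, ?_, ?_, ?_, ?_, ?_, ?_, ?_⟩ <;> decide +kernel
end

section
/- There exists a geometric (18_4) configuration (P, L) together with partitions P = P₁ ⊔ P₂ and L = L₁ ⊔ L₂ such that |P₁| = |P₂| = |L₁| = |L₂| = 9, every point of P₁ is incident to exactly 3 lines of L₁ and every line of L₁ is incident to exactly 3 points of P₁, and every point of P₂ is incident to exactly 3 lines of L₂ and every line of L₂ is incident to exactly 3 points of P₂; that is, the (18_4) configuration splits into two geometric (9_3) configurations. -/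
/- Model of the real projective plane: a point is a 1-dimensional linear subspace
of ℝ³ and a line is a 2-dimensional linear subspace of ℝ³; a point p is incident
to a line ℓ when p ≤ ℓ. -/

open scoped Classical

namespace Config18

/-- Coordinates of the eighteen points. An entry `![a, b, c]` stands for `a + b * d + c * d ^ 2`,
where `d` is the real root of `d ^ 3 = d ^ 2 + 1`. -/
def pointCoeff : Fin 18 → Fin 3 → Fin 3 → ℤ :=
  ![![![1, 0, 0], ![0, 0, 0], ![0, 0, 0]],
    ![![0, 0, 0], ![1, 0, 0], ![0, 0, 0]],
    ![![0, 0, 0], ![0, 0, 0], ![1, 0, 0]],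
    ![![1, 0, 0], ![1, 0, 0], ![1, 1, 0]],
    ![![0, 1, 0], ![-1, 1, 0], ![0, 0, 0]],
    ![![1, 0, 0], ![0, 0, 0], ![1, 0, -1]],
    ![![0, 0, 0], ![1, 0, -1], ![-1, 0, 0]],
    ![![1, 0, 0], ![2, 0, 1], ![1, 1, 0]],
    ![![1, 1, 0], ![1, 1, 0], ![0, 1, 0]],
    ![![1, 0, 0], ![1, 1, 0], ![1, 0, 0]],
    ![![1, 0, 0], ![1, 0, 0], ![1, 0, 0]],
    ![![1, 0, 0], ![0, 0, 0], ![1, 0, 0]],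
    ![![1, 0, 0], ![1, 1, 0], ![0, 0, 0]],
    ![![1, 0, 0], ![1, 1, 0], ![1, 1, 0]],
    ![![1, 0, 0], ![0, 0, -1], ![0, 0, -1]],
    ![![0, 0, 1], ![-1, -1, 0], ![0, -1, 0]],
    ![![0, 0, 0], ![0, 0, 1], ![1, 0, 0]],
    ![![0, 1, 0], ![0, 2, -1], ![-1, 0, 1]]]

/-- Coefficients of the equations of the eighteen lines, encoded as in `pointCoeff`. -/
def lineCoeff : Fin 18 → Fin 3 → Fin 3 → ℤ :=
  ![![![0, 1, -2], ![0, 0, 1], ![-1, -1, 0]],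
    ![![0, 1, -1], ![0, 0, 1], ![-1, -1, 0]],
    ![![1, 0, -1], ![0, 1, 1], ![-1, 0, 0]],
    ![![1, 0, 0], ![0, 0, 0], ![0, 0, 0]],
    ![![1, 0, 0], ![-1, 0, 0], ![0, 0, 0]],
    ![![0, 0, 0], ![0, 0, 0], ![1, 0, 0]],
    ![![0, 0, 0], ![0, 1, 0], ![-1, -1, 0]],
    ![![0, 0, 0], ![1, 0, 0], ![0, 0, 0]],
    ![![1, 1, 0], ![0, 0, 0], ![-1, 0, 0]],
    ![![1, 0, 0], ![0, 0, 0], ![-1, 0, 0]],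
    ![![1, 1, 0], ![-1, 0, 0], ![0, 0, 0]],
    ![![1, 1, -1], ![-1, 0, 0], ![0, 0, 1]],
    ![![0, 0, 0], ![1, 0, 0], ![-1, 0, 0]],
    ![![1, 0, -1], ![-1, 0, 0], ![0, 0, 1]],
    ![![1, 0, 0], ![0, 1, 0], ![-1, 0, 0]],
    ![![1, 1, 0], ![-1, 0, 0], ![-1, -1, 0]],
    ![![1, 1, 0], ![-1, 0, 0], ![0, 0, 1]],
    ![![0, 2, -1], ![0, 0, 1], ![-1, -1, 0]]]

/-- The indices of the four points on each line. -/
def support : Fin 18 → Finset (Fin 18) :=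
  ![{5, 6, 7, 9}, {4, 6, 8, 14}, {3, 4, 5, 17}, {1, 2, 6, 16},
    {2, 3, 8, 10}, {0, 1, 4, 12}, {0, 7, 8, 15}, {0, 2, 5, 11},
    {1, 3, 7, 13}, {1, 9, 10, 11}, {2, 9, 12, 13}, {4, 9, 15, 16},
    {0, 10, 13, 14}, {7, 10, 16, 17}, {3, 11, 14, 15}, {8, 11, 12, 17},
    {5, 12, 14, 16}, {6, 13, 15, 17}]

/-- Multiplication in `ℤ[d]` in the basis `1, d, d ^ 2`. -/
def mulCoeff (a b : Fin 3 → ℤ) : Fin 3 → ℤ :=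
  ![a 0 * b 0 + (a 1 * b 2 + a 2 * b 1) + a 2 * b 2,
    a 0 * b 1 + a 1 * b 0 + a 2 * b 2,
    a 0 * b 2 + a 1 * b 1 + a 2 * b 0 + (a 1 * b 2 + a 2 * b 1) + a 2 * b 2]

/-- The dot product of two vectors over `ℤ[d]`. -/
def dotCoeff (v w : Fin 3 → Fin 3 → ℤ) (k : Fin 3) : ℤ :=
  mulCoeff (v 0) (w 0) k + mulCoeff (v 1) (w 1) k + mulCoeff (v 2) (w 2) k

/-- The norm of an element of `ℤ[d]`. -/
def normCoeff (a : Fin 3 → ℤ) : ℤ :=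
  a 0 * (a 0 * (a 0 + a 1 + a 2) - (a 1 + a 2) * a 2) -
    a 2 * (a 1 * (a 0 + a 1 + a 2) - a 2 * a 2) +
    (a 1 + a 2) * (a 1 * (a 1 + a 2) - a 2 * a 0)

/-- The real number encoded by a coefficient vector. -/
def eval (d : ℝ) (a : Fin 3 → ℤ) : ℝ := a 0 + a 1 * d + a 2 * d ^ 2

lemma exists_root : ∃ d : ℝ, d ^ 3 = d ^ 2 + 1 := by
  have h := intermediate_value_Icc (f := fun x : ℝ => x ^ 3 - x ^ 2) (a := 0) (b := 2)
    (by norm_num) (by fun_prop)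
  obtain ⟨d, -, hd⟩ := h (show (1 : ℝ) ∈ _ by norm_num)
  exact ⟨d, by linarith [show d ^ 3 - d ^ 2 = 1 from hd]⟩

lemma eval_mulCoeff {d : ℝ} (hd : d ^ 3 = d ^ 2 + 1) (a b : Fin 3 → ℤ) :
    eval d (mulCoeff a b) = eval d a * eval d b := by
  simp only [eval, mulCoeff, Matrix.cons_val]
  push_cast
  linear_combination (-(a 1 * b 2 + a 2 * b 1 : ℝ) - a 2 * b 2 * (d + 1)) * hd

lemma eval_dotCoeff {d : ℝ} (hd : d ^ 3 = d ^ 2 + 1) (v w : Fin 3 → Fin 3 → ℤ) :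
    eval d (dotCoeff v w) = (fun k => eval d (v k)) ⬝ᵥ fun k => eval d (w k) := by
  simp only [dotProduct, Fin.sum_univ_three, ← eval_mulCoeff hd]
  simp only [eval, dotCoeff]
  push_cast
  ring

lemma eval_ne_zero {d : ℝ} (hd : d ^ 3 = d ^ 2 + 1) {a : Fin 3 → ℤ} (ha : normCoeff a ≠ 0) :
    eval d a ≠ 0 := by
  intro h
  simp only [eval] at h
  have h₁ : (a 2 : ℝ) + a 0 * d + (a 1 + a 2) * d ^ 2 = 0 := by
    linear_combination d * h - a 2 * hd
  have h₂ : (a 1 + a 2 : ℝ) + a 2 * d + (a 0 + a 1 + a 2) * d ^ 2 = 0 := by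
    linear_combination d * h₁ - (a 1 + a 2) * hd
  apply ha
  have : (normCoeff a : ℝ) = 0 := by
    simp only [normCoeff]
    push_cast
    linear_combination (a 0 * (a 0 + a 1 + a 2) - (a 1 + a 2) * a 2 : ℝ) * h -
      (a 1 * (a 0 + a 1 + a 2) - a 2 * a 2 : ℝ) * h₁ +
      (a 1 * (a 1 + a 2) - a 2 * a 0 : ℝ) * h₂
  exact_mod_cast this

lemma dotCoeff_table (i j : Fin 18) :
    (i ∈ support j ∧ ∀ k, dotCoeff (pointCoeff i) (lineCoeff j) k = 0) ∨
      (i ∉ support j ∧ normCoeff (dotCoeff (pointCoeff i) (lineCoeff j)) ≠ 0) := by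
  revert i j
  decide +kernel

/-- Homogeneous coordinates of a point. -/
def pointVec (d : ℝ) (i : Fin 18) : Fin 3 → ℝ := fun k => eval d (pointCoeff i k)

/-- Coefficients of the equation of a line. -/
def lineVec (d : ℝ) (j : Fin 18) : Fin 3 → ℝ := fun k => eval d (lineCoeff j k)

lemma dotProduct_eq_zero_iff {d : ℝ} (hd : d ^ 3 = d ^ 2 + 1) (i j : Fin 18) :
    lineVec d j ⬝ᵥ pointVec d i = 0 ↔ i ∈ support j := by
  rw [dotProduct_comm, show pointVec d i ⬝ᵥ lineVec d j = _ from (eval_dotCoeff hd _ _).symm]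
  obtain ⟨h, h0⟩ | ⟨h, h0⟩ := dotCoeff_table i j
  · simp [h, eval, h0]
  · simp [h, eval_ne_zero hd h0]

/-- A point of the configuration. -/
noncomputable def point (d : ℝ) (i : Fin 18) : Submodule ℝ (Fin 3 → ℝ) :=
  Submodule.span ℝ {pointVec d i}

/-- A line of the configuration. -/
noncomputable def line (d : ℝ) (j : Fin 18) : Submodule ℝ (Fin 3 → ℝ) :=
  LinearMap.ker (dotProductEquiv ℝ (Fin 3) (lineVec d j))

lemma point_le_line_iff {d : ℝ} (hd : d ^ 3 = d ^ 2 + 1) (i j : Fin 18) :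
    point d i ≤ line d j ↔ i ∈ support j := by
  rw [← dotProduct_eq_zero_iff hd, point, line, Submodule.span_singleton_le_iff_mem]
  simp

lemma isProjPoint_point {d : ℝ} (hd : d ^ 3 = d ^ 2 + 1) (i : Fin 18) :
    IsProjPoint (point d i) := by
  obtain ⟨j, hj⟩ : ∃ j, i ∉ support j := by revert i; decide +kernel
  refine finrank_span_singleton fun h => hj ?_
  simp [← dotProduct_eq_zero_iff hd, h]

lemma isProjLine_line {d : ℝ} (hd : d ^ 3 = d ^ 2 + 1) (j : Fin 18) :
    IsProjLine (line d j) := by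
  obtain ⟨i, hi⟩ : ∃ i, i ∉ support j := by revert j; decide +kernel
  have hne : dotProductEquiv ℝ (Fin 3) (lineVec d j) ≠ 0 := fun h => hi <| by
    rw [← dotProduct_eq_zero_iff hd, (LinearEquiv.map_eq_zero_iff _).1 h, zero_dotProduct]
  have := Module.Dual.finrank_ker_add_one_of_ne_zero hne
  rw [Module.finrank_fin_fun] at this
  unfold IsProjLine line
  omega

lemma point_injective {d : ℝ} (hd : d ^ 3 = d ^ 2 + 1) : Function.Injective (point d) := by
  have key : ∀ i i', (∀ j, i ∈ support j ↔ i' ∈ support j) → i = i' := by decide +kernel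
  exact fun i i' h => key i i' fun j => by
    rw [← point_le_line_iff hd, ← point_le_line_iff hd, h]

lemma line_injective {d : ℝ} (hd : d ^ 3 = d ^ 2 + 1) : Function.Injective (line d) := by
  have key : ∀ j j', support j = support j' → j = j' := by decide +kernel
  exact fun j j' h => key j j' <| Finset.ext fun i => by
    rw [← point_le_line_iff hd, ← point_le_line_iff hd, h]

lemma pointDeg_map {d : ℝ} (hd : d ^ 3 = d ^ 2 + 1) (S : Finset (Fin 18)) (i : Fin 18) :
    pointDeg (S.map ⟨line d, line_injective hd⟩) (point d i) =
      (S.filter fun j => i ∈ support j).card := by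
  rw [pointDeg, Finset.filter_map, Finset.card_map]
  congr 1
  ext j
  simp [point_le_line_iff hd]

lemma lineDeg_map {d : ℝ} (hd : d ^ 3 = d ^ 2 + 1) (S : Finset (Fin 18)) (j : Fin 18) :
    lineDeg (S.map ⟨point d, point_injective hd⟩) (line d j) =
      (S.filter fun i => i ∈ support j).card := by
  rw [lineDeg, Finset.filter_map, Finset.card_map]
  congr 1
  ext i
  simp [point_le_line_iff hd]

end Config18

open Config18 in
theorem stmt8 :
    ∃ P L P₁ P₂ L₁ L₂ : Finset (Submodule ℝ (Fin 3 → ℝ)),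
      (∀ p ∈ P, IsProjPoint p) ∧ (∀ l ∈ L, IsProjLine l) ∧
      P.card = 18 ∧ L.card = 18 ∧
      (∀ p ∈ P, pointDeg L p = 4) ∧ (∀ l ∈ L, lineDeg P l = 4) ∧
      Disjoint P₁ P₂ ∧ P₁ ∪ P₂ = P ∧ Disjoint L₁ L₂ ∧ L₁ ∪ L₂ = L ∧
      P₁.card = 9 ∧ P₂.card = 9 ∧ L₁.card = 9 ∧ L₂.card = 9 ∧
      (∀ p ∈ P₁, pointDeg L₁ p = 3) ∧ (∀ l ∈ L₁, lineDeg P₁ l = 3) ∧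
      (∀ p ∈ P₂, pointDeg L₂ p = 3) ∧ (∀ l ∈ L₂, lineDeg P₂ l = 3) := by
  obtain ⟨d, hd⟩ := exists_root
  let A : Finset (Fin 18) := Finset.univ.filter (· < 9)
  let B : Finset (Fin 18) := Finset.univ.filter (9 ≤ ·)
  have hAB : Disjoint A B := by decide +kernel
  have hU : A ∪ B = Finset.univ := by decide +kernel
  have hA : A.card = 9 := by decide +kernel
  have hB : B.card = 9 := by decide +kernel
  let f : Fin 18 ↪ Submodule ℝ (Fin 3 → ℝ) := ⟨point d, point_injective hd⟩
  let g : Fin 18 ↪ Submodule ℝ (Fin 3 → ℝ) := ⟨line d, line_injective hd⟩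
  refine ⟨Finset.univ.map f, Finset.univ.map g, A.map f, B.map f, A.map g, B.map g,
    ?_, ?_, by simp, by simp, ?_, ?_, (Finset.disjoint_map f).2 hAB, ?_,
    (Finset.disjoint_map g).2 hAB, ?_, by simp [hA], by simp [hB], by simp [hA], by simp [hB],
    ?_, ?_, ?_, ?_⟩
  · exact Finset.forall_mem_map.2 fun i _ => isProjPoint_point hd i
  · exact Finset.forall_mem_map.2 fun j _ => isProjLine_line hd j
  · refine Finset.forall_mem_map.2 fun i _ => (pointDeg_map hd _ i).trans ?_
    revert i; decide +kernel
  · refine Finset.forall_mem_map.2 fun j _ => (lineDeg_map hd _ j).trans ?_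
    revert j; decide +kernel
  · rw [← hU, Finset.map_union]
  · rw [← hU, Finset.map_union]
  · refine Finset.forall_mem_map.2 fun i hi => (pointDeg_map hd _ i).trans ?_
    revert i; decide +kernel
  · refine Finset.forall_mem_map.2 fun j hj => (lineDeg_map hd _ j).trans ?_
    revert j; decide +kernel
  · refine Finset.forall_mem_map.2 fun i hi => (pointDeg_map hd _ i).trans ?_
    revert i; decide +kernel
  · refine Finset.forall_mem_map.2 fun j hj => (lineDeg_map hd _ j).trans ?_
    revert j; decide +kernel
end
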